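/- arXiv:math/0209284 — 4 statements merged into one kernel-verified Lean document; each statement's English description precedes it below -/
import Mathlib

section
/- Let λ = (λ_1,…,λ_n) be a vector of positive integers, L = lcm(λ_1,…,λ_n), ω_i = L/λ_i. Let S be the additive submonoid of ℤ^{n+1} generated by the elements (e_i, 0) for i = 1,…,n (where e_i is the i-th standard basis vector) together with all (β, 1) with β ∈ ℕ^n and ω·β ≥ L, and let σ : ℤ^{n+1} → ℤ be the linear form σ(α, d) = ω·α − L d. Then grp(S ∩ ker σ) = grp(S) ∩ ker σ, i.e., the subgroup of ℤ^{n+1} generated by { s ∈ S | σ(s) = 0 } equals the intersection of the subgroup generated by S with the kernel of σ. Moreover grp(S) = ℤ^{n+1}. -/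
/-- If `x * u = y * v`, then `(u, v)` and `(y, x)` are multiples of a common pair `(a, b)`. -/
theorem exists_gcd_decomposition {u v x y : ℕ} (hu : 0 < u) (hv : 0 < v) (h : x * u = y * v) :
    ∃ g a b t : ℕ, 0 < g ∧ u = g * a ∧ v = g * b ∧ y = a * t ∧ x = b * t := by
  have hg : 0 < Nat.gcd u v := Nat.gcd_pos_of_pos_left v hu
  obtain ⟨a, b, hab, ha, hb⟩ := Nat.exists_coprime u v
  have hxy : x * a = y * b := by
    apply Nat.eq_of_mul_eq_mul_right hg
    calc x * a * Nat.gcd u v = x * u := by conv_rhs => rw [ha, ← mul_assoc]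
      _ = y * v := h
      _ = y * b * Nat.gcd u v := by conv_lhs => rw [hb, ← mul_assoc]
  obtain ⟨t, ht⟩ : b ∣ x := hab.symm.dvd_of_dvd_mul_right ⟨y, by rw [hxy, mul_comm]⟩
  have hbpos : 0 < b := Nat.pos_of_ne_zero fun h0 => by
    rw [h0, zero_mul] at hb
    omega
  refine ⟨Nat.gcd u v, a, b, t, hg, by rw [mul_comm]; exact ha, by rw [mul_comm]; exact hb, ?_, ht⟩
  apply Nat.eq_of_mul_eq_mul_right hbpos
  rw [← hxy, ht]
  ring

/-- The quotients of `lcm lam` by the `lam k` have no common divisor. -/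
theorem isUnit_of_dvd_lcm_quotients {ι : Type*} [Fintype ι] {lam ω : ι → ℕ}
    (hlam : ∀ i, 0 < lam i) (h : ∀ k, ω k * lam k = Finset.univ.lcm lam) {m : ℤ}
    (hm : ∀ k, m ∣ (ω k : ℤ)) [Nonempty ι] : IsUnit m := by
  rw [Int.isUnit_iff_natAbs_eq]
  have hm' : ∀ k, m.natAbs ∣ ω k := fun k => Int.natCast_dvd_natCast.1 (by simpa using hm k)
  have hLpos : 0 < Finset.univ.lcm lam :=
    Nat.pos_of_ne_zero fun h0 => by
      obtain ⟨i, -, hi⟩ := Finset.lcm_eq_zero_iff.1 h0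
      exact (hlam i).ne' hi
  let k0 : ι := Classical.arbitrary ι
  obtain ⟨q, hq⟩ : m.natAbs ∣ Finset.univ.lcm lam :=
    (hm' k0).trans ⟨lam k0, (h k0).symm⟩
  have hmpos : 0 < m.natAbs := Nat.pos_of_ne_zero fun h0 => by
    rw [h0, zero_mul] at hq
    omega
  have hqpos : 0 < q := Nat.pos_of_ne_zero fun h0 => by
    rw [h0, mul_zero] at hq
    omega
  have hdvd : Finset.univ.lcm lam ∣ q := Finset.lcm_dvd fun k _ => by
    obtain ⟨c, hc⟩ := hm' k
    refine ⟨c, Nat.eq_of_mul_eq_mul_left hmpos ?_⟩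
    rw [← hq, ← h k, hc]
    ring
  have hle := Nat.le_of_dvd hqpos hdvd
  rw [hq] at hle
  nlinarith

/-- An element lies in a subgroup as soon as coprime multiples of it do. -/
theorem mem_of_forall_zsmul_mem {ι G : Type*} [AddCommGroup G] (H : AddSubgroup G) (v : G)
    (c : ι → ℤ) (hc : ∀ m : ℤ, (∀ k, m ∣ c k) → IsUnit m) (hv : ∀ k, c k • v ∈ H) : v ∈ H := by
  let J : Ideal ℤ :=
    (AddSubgroup.toIntSubmodule H).comap (LinearMap.toSpanSingleton ℤ G v)
  have hJ : ∀ m : ℤ, m ∈ J ↔ m • v ∈ H := fun m => Iff.rfl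
  obtain ⟨m, hm⟩ := (IsPrincipalIdealRing.principal J).principal
  have hm' : J = Ideal.span {m} := hm
  have hu : IsUnit m := hc m fun k =>
    Ideal.mem_span_singleton.1 (hm' ▸ (hJ (c k)).2 (hv k))
  have h1 : (1 : ℤ) ∈ J := by
    rw [hm', Ideal.span_singleton_eq_top.2 hu]
    trivial
  simpa using (hJ 1).1 h1


/-- Let `λ` be positive integers, `L = lcm(λ)`, `ω_i = L/λ_i`.  Let
`S ⊆ ℤ^{n+1}` be the submonoid generated by `(e_i, 0)` (`i = 1, …, n`) together with all
`(β, 1)` with `β ∈ ℕ^n` and `ω·β ≥ L`, and let `σ(α, d) = ω·α − Ld`.  Then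
`grp(S ∩ ker σ) = grp(S) ∩ ker σ`, and moreover `grp(S) = ℤ^{n+1}`. -/
theorem grp_inter_ker_sigma
    {n : ℕ} (hn : 0 < n)
    (lam : Fin n → ℕ) (hlam : ∀ i, 0 < lam i)
    (L : ℕ) (hL : L = Finset.univ.lcm lam)
    (ω : Fin n → ℕ) (hω : ∀ i, ω i = L / lam i)
    (S : AddSubmonoid ((Fin n → ℤ) × ℤ))
    (hS : S = AddSubmonoid.closure
      ((Set.range fun i : Fin n =>
          (((fun j => if j = i then (1 : ℤ) else 0) : Fin n → ℤ), (0 : ℤ))) ∪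
        {v : (Fin n → ℤ) × ℤ | ∃ β : Fin n → ℕ,
          (L ≤ ∑ i, ω i * β i) ∧ v = ((fun j => (β j : ℤ)), (1 : ℤ))}))
    (σ : (Fin n → ℤ) × ℤ →+ ℤ)
    (hσ : ∀ v : (Fin n → ℤ) × ℤ, σ v = (∑ i, (ω i : ℤ) * v.1 i) - (L : ℤ) * v.2) :
    (((AddSubgroup.closure {s : (Fin n → ℤ) × ℤ | s ∈ S ∧ σ s = 0}) :
        Set ((Fin n → ℤ) × ℤ)) =
      {v : (Fin n → ℤ) × ℤ |
        v ∈ AddSubgroup.closure (S : Set ((Fin n → ℤ) × ℤ)) ∧ σ v = 0}) ∧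
    AddSubgroup.closure (S : Set ((Fin n → ℤ) × ℤ)) = ⊤ := by
  have hωlam : ∀ k, ω k * lam k = L := fun k => by
    rw [hω k]
    exact Nat.div_mul_cancel (hL ▸ Finset.dvd_lcm (Finset.mem_univ k))
  let e : Fin n → (Fin n → ℤ) × ℤ := fun i => (Pi.single i 1, 0)
  let p : Fin n → (Fin n → ℤ) × ℤ := fun i => (Pi.single i (lam i : ℤ), 1)
  have heS : ∀ i, e i ∈ S := fun i => by
    rw [hS]
    refine AddSubmonoid.subset_closure (Or.inl ⟨i, ?_⟩)
    ext j <;> simp [e, Pi.single_apply]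
  have hβS : ∀ β : Fin n → ℕ, ∑ i, ω i * β i = L →
      (((fun j => (β j : ℤ)), (1 : ℤ)) : (Fin n → ℤ) × ℤ) ∈ {s | s ∈ S ∧ σ s = 0} := by
    intro β hβ
    refine ⟨?_, ?_⟩
    · rw [hS]
      exact AddSubmonoid.subset_closure (Or.inr ⟨β, hβ.ge, rfl⟩)
    · rw [hσ, ← hβ]
      push_cast
      ring
  set G := AddSubgroup.closure {s : (Fin n → ℤ) × ℤ | s ∈ S ∧ σ s = 0} with hG
  have hp : ∀ i, p i ∈ {s | s ∈ S ∧ σ s = 0} := fun i => by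
    convert hβS (Pi.single i (lam i)) (by simp [Pi.single_apply, hωlam]) using 1
    ext j <;> simp [p, Pi.single_apply]
  have hdecomp : ∀ v : (Fin n → ℤ) × ℤ, ∀ k,
      v = ∑ i, v.1 i • e i + v.2 • (p k - (lam k : ℤ) • e k) := by
    intro v k
    ext j
    · simp [e, p, Pi.single_apply, Finset.sum_apply, Prod.fst_sum]
    · simp [e, p, Prod.snd_sum]
  have htop : AddSubgroup.closure (S : Set ((Fin n → ℤ) × ℤ)) = ⊤ := by
    rw [eq_top_iff]
    intro v _
    have he : ∀ i, e i ∈ AddSubgroup.closure (S : Set ((Fin n → ℤ) × ℤ)) := fun i =>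
      AddSubgroup.subset_closure (heS i)
    rw [hdecomp v ⟨0, hn⟩]
    exact add_mem (sum_mem fun i _ => zsmul_mem (he i) _)
      (zsmul_mem (sub_mem (AddSubgroup.subset_closure (hp _).1) (zsmul_mem (he _) _)) _)
  have hpair : ∀ i k, (ω k : ℤ) • e i - (ω i : ℤ) • e k ∈ G := by
    intro i k
    obtain ⟨g, a, b, t, hg, hla, hlb, hk, hi⟩ :=
      exists_gcd_decomposition (hlam i) (hlam k) ((hωlam i).trans (hωlam k).symm)
    obtain ⟨g, rfl⟩ : ∃ g', g = g' + 1 := ⟨g - 1, by omega⟩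
    have hq := AddSubgroup.subset_closure
      (hβS (Pi.single i (g * a) + Pi.single k b) (by
        simp only [Pi.add_apply, mul_add, Finset.sum_add_distrib, Pi.single_apply, mul_ite,
          mul_zero, Finset.sum_ite_eq', Finset.mem_univ, if_true]
        rw [← hωlam i, hla, hi, hk]
        ring))
    convert zsmul_mem (sub_mem (AddSubgroup.subset_closure (hp i)) hq) (t : ℤ) using 1
    ext j
    · simp only [e, p, hla, hi, hk, Pi.single_apply, Prod.fst_sub, Prod.smul_fst, Pi.sub_apply,
        Pi.smul_apply, smul_eq_mul, Pi.add_apply]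
      push_cast
      split_ifs <;> ring
    · simp [e, p]
  refine ⟨Set.Subset.antisymm ?_ ?_, htop⟩
  · intro v hv
    refine ⟨htop ▸ AddSubgroup.mem_top v, ?_⟩
    have hle : G ≤ σ.ker := (AddSubgroup.closure_le _).2 fun s hs => hs.2
    exact hle hv
  · rintro v ⟨-, hv⟩
    have : Nonempty (Fin n) := ⟨⟨0, hn⟩⟩
    refine mem_of_forall_zsmul_mem G v (fun k => (ω k : ℤ))
      (fun m hm => isUnit_of_dvd_lcm_quotients hlam (fun k => hL ▸ hωlam k) hm) fun k => ?_
    have hsum : (∑ i, (ω i : ℤ) * v.1 i) = L * v.2 := by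
      rw [hσ] at hv
      exact sub_eq_zero.1 hv
    have hkey : (ω k : ℤ) • v =
        ∑ i, v.1 i • ((ω k : ℤ) • e i - (ω i : ℤ) • e k) + ((ω k : ℤ) * v.2) • p k := by
      have hrest : (∑ i, v.1 i * (ω i : ℤ)) = ω k * lam k * v.2 := by
        rw [← Nat.cast_mul, hωlam k, ← hsum]
        exact Finset.sum_congr rfl fun i _ => mul_comm _ _
      have hsplit : ∑ i, v.1 i • ((ω k : ℤ) • e i - (ω i : ℤ) • e k) =
          (ω k : ℤ) • ∑ i, v.1 i • e i - (∑ i, v.1 i * (ω i : ℤ)) • e k := by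
        simp only [smul_sub, Finset.sum_sub_distrib, Finset.smul_sum, Finset.sum_smul, mul_smul]
        congr 1
        exact Finset.sum_congr rfl fun i _ => smul_comm _ _ _
      rw [hsplit, hrest]
      conv_lhs => rw [hdecomp v k]
      module
    rw [hkey]
    exact add_mem (sum_mem fun i _ => zsmul_mem (hpair i k) _)
      (zsmul_mem (AddSubgroup.subset_closure (hp k)) _)
end

section
/- Let K be a field, S an additive submonoid of ℤ^m, and R = K[S] the monoid algebra of S over K, with monomial basis { x^s | s ∈ S }. Let σ : ℤ^m → ℤ be a group homomorphism with σ(s) ≥ 0 for all s ∈ S, and let P be the ideal of R generated by the monomials { x^s | s ∈ S, σ(s) > 0 }; assume P is a prime ideal. Suppose (i) there exists γ ∈ S with σ(γ) = 1, and (ii) the subgroup of ℤ^m generated by S ∩ ker σ equals grp(S) ∩ ker σ. Then the extension of P to the localization R_P of R at P is the principal ideal generated by the image of x^γ. -/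
/-- Every element of the subgroup generated by a submonoid of a commutative group is a difference
of two elements of the submonoid. -/
theorem AddSubmonoid.exists_add_eq_of_mem_addSubgroup_closure {G : Type*} [AddCommGroup G]
    (T : AddSubmonoid G) {v : G} (hv : v ∈ AddSubgroup.closure (T : Set G)) :
    ∃ a ∈ T, ∃ b ∈ T, v + b = a := by
  induction hv using AddSubgroup.closure_induction with
  | mem x hx => exact ⟨x, hx, 0, T.zero_mem, add_zero x⟩
  | zero => exact ⟨0, T.zero_mem, 0, T.zero_mem, add_zero 0⟩
  | add x y _ _ hx hy =>
    obtain ⟨a, ha, b, hb, rfl⟩ := hx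
    obtain ⟨c, hc, d, hd, rfl⟩ := hy
    exact ⟨_, T.add_mem ha hc, _, T.add_mem hb hd, by abel⟩
  | neg x _ hx =>
    obtain ⟨a, ha, b, hb, rfl⟩ := hx
    exact ⟨b, hb, _, ha, by abel⟩

/-- A monomial of degree zero does not lie in the ideal generated by the monomials of positive
degree, when all degrees are nonnegative. -/
theorem AddMonoidAlgebra.single_notMem_span_of_pos {K M : Type*} [Semiring K] [Nontrivial K]
    [AddCommMonoid M] (f : M →+ ℤ) (hf : ∀ s, 0 ≤ f s) {b : M} (hb : f b = 0) :
    AddMonoidAlgebra.single b (1 : K) ∉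
      Ideal.span {p : AddMonoidAlgebra K M |
        ∃ s : M, 0 < f s ∧ p = AddMonoidAlgebra.single s (1 : K)} := by
  intro h
  have himage : {p : AddMonoidAlgebra K M |
      ∃ s : M, 0 < f s ∧ p = AddMonoidAlgebra.single s (1 : K)} =
      AddMonoidAlgebra.of' K M '' {s | 0 < f s} := by
    ext p
    simp [AddMonoidAlgebra.of'_apply, eq_comm]
  rw [himage, AddMonoidAlgebra.mem_ideal_span_of'_image] at h
  obtain ⟨s, hs, d, rfl⟩ := h b (by simp)
  rw [map_add] at hb
  have := hf d
  rw [Set.mem_ofPred_eq] at hs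
  omega


/-- Let `K` be a field, `S` an additive submonoid of `ℤ^m`, and
`R = K[S]` its monoid algebra.  Let `σ : ℤ^m → ℤ` be a group homomorphism with `σ ≥ 0`
on `S`, and let `P` be the ideal of `R` generated by the monomials `x^s` with `σ(s) > 0`;
assume `P` is prime.  If (i) there is `γ ∈ S` with `σ(γ) = 1` and (ii)
`grp(S ∩ ker σ) = grp(S) ∩ ker σ`, then the extension of `P` to the localization `R_P`
is the principal ideal generated by the image of `x^γ`. -/
theorem localization_at_facet_prime_principal
    {K : Type*} [Field K] {m : ℕ}
    (S : AddSubmonoid (Fin m → ℤ))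
    (σ : (Fin m → ℤ) →+ ℤ)
    (hσnn : ∀ s ∈ S, 0 ≤ σ s)
    (P : Ideal (AddMonoidAlgebra K S))
    (hP : P = Ideal.span {p : AddMonoidAlgebra K S |
      ∃ s : S, 0 < σ (s : Fin m → ℤ) ∧ p = AddMonoidAlgebra.single s (1 : K)})
    (hprime : P.IsPrime)
    (γ : Fin m → ℤ) (hγS : γ ∈ S) (hγ : σ γ = 1)
    (hgrp : ((AddSubgroup.closure {v : Fin m → ℤ | v ∈ S ∧ σ v = 0}) : Set (Fin m → ℤ)) =
      {v : Fin m → ℤ | v ∈ AddSubgroup.closure (S : Set (Fin m → ℤ)) ∧ σ v = 0}) :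
    Ideal.map (algebraMap (AddMonoidAlgebra K S) (Localization.AtPrime P)) P =
      Ideal.span {algebraMap (AddMonoidAlgebra K S) (Localization.AtPrime P)
        (AddMonoidAlgebra.single (⟨γ, hγS⟩ : S) (1 : K))} := by
  let R := AddMonoidAlgebra K S
  let T : AddSubmonoid (Fin m → ℤ) := S ⊓ AddMonoidHom.mker σ
  have hT : {v : Fin m → ℤ | v ∈ S ∧ σ v = 0} = T := rfl
  apply le_antisymm
  · rw [Ideal.map_le_iff_le_comap]
    conv_lhs => rw [hP]
    rw [Ideal.span_le]
    rintro _ ⟨s, hs, rfl⟩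
    obtain ⟨n, hn⟩ := Int.eq_succ_of_zero_lt hs
    have hmem : (s : Fin m → ℤ) - (n + 1) • γ ∈ AddSubgroup.closure (T : Set (Fin m → ℤ)) := by
      rw [hT] at hgrp
      rw [← SetLike.mem_coe, hgrp]
      refine ⟨sub_mem (AddSubgroup.subset_closure s.2)
        (nsmul_mem (AddSubgroup.subset_closure hγS) _), ?_⟩
      rw [map_sub, map_nsmul, hγ, hn]
      simp
    obtain ⟨a, ha, b, hb, hab⟩ := T.exists_add_eq_of_mem_addSubgroup_closure hmem
    have hbP : (AddMonoidAlgebra.single (⟨b, hb.1⟩ : S) (1 : K) : R) ∈ P.primeCompl := by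
      rw [Ideal.mem_primeCompl_iff, hP]
      exact AddMonoidAlgebra.single_notMem_span_of_pos (σ.comp S.subtype)
        (fun s => hσnn s s.2) hb.2
    have hmul : (AddMonoidAlgebra.single s 1 : R) * AddMonoidAlgebra.single ⟨b, hb.1⟩ 1 =
        AddMonoidAlgebra.single ⟨γ, hγS⟩ 1 *
          AddMonoidAlgebra.single (n • ⟨γ, hγS⟩ + ⟨a, ha.1⟩) 1 := by
      rw [AddMonoidAlgebra.single_mul_single, AddMonoidAlgebra.single_mul_single]
      congr 1
      ext1
      simp only [AddSubmonoid.coe_add, AddSubmonoidClass.coe_nsmul, ← hab, succ_nsmul]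
      abel
    rw [SetLike.mem_coe, Ideal.mem_comap, ← Ideal.mul_unit_mem_iff_mem _
      (IsLocalization.map_units (Localization.AtPrime P) ⟨_, hbP⟩), ← map_mul, hmul, map_mul]
    exact Ideal.mul_mem_right _ _ (Ideal.mem_span_singleton_self _)
  · rw [Ideal.span_singleton_le_iff_mem]
    refine Ideal.mem_map_of_mem _ ?_
    rw [hP]
    exact Ideal.subset_span ⟨⟨γ, hγS⟩, by simp [hγ], rfl⟩
end

section
/- Let K be a field, n ≥ 1, λ = (λ_1,…,λ_n) a vector of positive integers, L = lcm(λ_1,…,λ_n), ω_i = L/λ_i, R = K[x_1,…,x_n], and I = I(λ). Then the Rees algebra R[It] satisfies Serre's condition R_1 — that is, for every prime ideal P of R[It] of height at most 1, the localization of R[It] at P is a regular local ring — if and only if there exists α ∈ ℕ^n with ω·α = L + 1, equivalently L + 1 lies in the additive submonoid of ℕ generated by ω_1,…,ω_n. -/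
/-- `x` is integral over the ideal `I`: there are `m ≥ 1` and `a j ∈ I ^ j` (`j = 1, …, m`)
with `x ^ m + a 1 * x ^ (m - 1) + ⋯ + a m = 0`. -/
def IdealIntegral {R : Type*} [CommRing R] (I : Ideal R) (x : R) : Prop :=
  ∃ m : ℕ, 0 < m ∧ ∃ a : ℕ → R, (∀ j ∈ Finset.Icc 1 m, a j ∈ I ^ j) ∧
    x ^ m + ∑ j ∈ Finset.Icc 1 m, a j * x ^ (m - j) = 0

/-- `A` is a regular local ring: `A` is Noetherian, has a unique maximal ideal `M`, and
`M` can be generated by `d` elements where `d = dim A` is the Krull dimension of `A`. -/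
def IsRegularLocal (A : Type*) [CommRing A] : Prop :=
  IsNoetherianRing A ∧
    ∃ M : Ideal A, M.IsMaximal ∧ (∀ N : Ideal A, N.IsMaximal → N = M) ∧
      ∃ s : Finset A, Ideal.span (s : Set A) = M ∧ (s.card : WithBot ℕ∞) = ringKrullDim A

theorem eq_of_le_of_ringKrullDim_localization_le_one {A : Type*} [CommRing A] [IsDomain A]
    {P P' : Ideal A} [P.IsPrime] [P'.IsPrime] (hP : ringKrullDim (Localization.AtPrime P) ≤ 1)
    (hle : P' ≤ P) (hne : P' ≠ ⊥) : P' = P := by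
  rw [IsLocalization.AtPrime.ringKrullDim_eq_height P] at hP
  have hP1 : P.height ≤ 1 := by exact_mod_cast hP
  by_contra h
  have h1 := Ideal.height_add_one_le_of_lt_of_isPrime (lt_of_le_of_ne hle h)
  have h2 : (⊥ : Ideal A).height + 1 ≤ P'.height :=
    Ideal.height_add_one_le_of_lt_of_isPrime (bot_lt_iff_ne_bot.mpr hne)
  have h3 : (1 : ℕ∞) + 1 ≤ 1 := by
    calc (1 : ℕ∞) + 1 ≤ P'.height + 1 := by
          gcongr
          exact le_trans (by simp) h2
      _ ≤ P.height := h1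
      _ ≤ 1 := hP1
  exact absurd h3 (by decide)

theorem maximalIdeal_localization_eq_span_singleton {A : Type*} [CommRing A]
    {P : Ideal A} [P.IsPrime] {π : A} (hπ : π ∈ P)
    (h : ∀ a ∈ P, ∃ s ∉ P, ∃ b, s * a = π * b) :
    IsLocalRing.maximalIdeal (Localization.AtPrime P) =
      Ideal.span {algebraMap A (Localization.AtPrime P) π} := by
  rw [← Localization.AtPrime.map_eq_maximalIdeal]
  apply le_antisymm
  · rw [Ideal.map_le_iff_le_comap]
    intro a ha
    obtain ⟨s, hs, b, hb⟩ := h a ha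
    have hu : IsUnit (algebraMap A (Localization.AtPrime P) s) :=
      IsLocalization.map_units (Localization.AtPrime P) (⟨s, hs⟩ : P.primeCompl)
    rw [Ideal.mem_comap, ← Ideal.unit_mul_mem_iff_mem _ hu, ← map_mul, hb, map_mul]
    exact Ideal.mul_mem_right _ _ (Ideal.mem_span_singleton_self _)
  · rw [Ideal.span_singleton_le_iff_mem]
    exact Ideal.mem_map_of_mem _ hπ

theorem isRegularLocal_localization {A : Type*} [CommRing A] [IsDomain A] [IsNoetherianRing A]
    {P : Ideal A} [P.IsPrime] (hP : ringKrullDim (Localization.AtPrime P) ≤ 1)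
    {π : A} (hπ : π ∈ P) (h : ∀ a ∈ P, ∃ s ∉ P, ∃ b, s * a = π * b) :
    IsRegularLocal (Localization.AtPrime P) := by
  have hmax := maximalIdeal_localization_eq_span_singleton hπ h
  refine ⟨IsLocalization.isNoetherianRing P.primeCompl _ inferInstance,
    IsLocalRing.maximalIdeal _, inferInstance, fun N hN => IsLocalRing.eq_maximalIdeal hN, ?_⟩
  by_cases hb : P = ⊥
  · refine ⟨∅, ?_, ?_⟩
    · have : π = 0 := by simpa [hb] using hπ
      simp [hmax, this]
    · rw [IsLocalization.AtPrime.ringKrullDim_eq_height P]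
      simp [hb]
  · refine ⟨{algebraMap A _ π}, by simp [hmax], ?_⟩
    rw [IsLocalization.AtPrime.ringKrullDim_eq_height P] at hP ⊢
    have h2 : (⊥ : Ideal A).height + 1 ≤ P.height :=
      Ideal.height_add_one_le_of_lt_of_isPrime (bot_lt_iff_ne_bot.mpr hb)
    have hP1 : P.height ≤ 1 := by exact_mod_cast hP
    have h3 : P.height = 1 := le_antisymm hP1 (le_trans (by simp) h2)
    simp [h3]

theorem IsRegularLocal.exists_generator {A : Type*} [CommRing A]
    {P : Ideal A} [P.IsPrime] (hreg : IsRegularLocal (Localization.AtPrime P))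
    (hP : ringKrullDim (Localization.AtPrime P) ≤ 1) :
    ∃ π ∈ P, ∀ a ∈ P, ∃ s ∉ P, ∃ b, s * a = π * b := by
  obtain ⟨-, M, hM, -, s, hs, hcard⟩ := hreg
  obtain rfl := IsLocalRing.eq_maximalIdeal hM
  have hle : s.card ≤ 1 := by
    rw [← hcard] at hP
    exact_mod_cast hP
  obtain ⟨p, hp⟩ : ∃ p, IsLocalRing.maximalIdeal (Localization.AtPrime P) = Ideal.span {p} := by
    obtain ⟨p, hp⟩ := Finset.card_le_one_iff_subset_singleton.mp hle
    rcases Finset.subset_singleton_iff.mp hp with h | h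
    · exact ⟨0, by rw [← hs, h]; simp⟩
    · exact ⟨p, by rw [← hs, h]; simp⟩
  obtain ⟨⟨π, t⟩, hπ⟩ := IsLocalization.surj P.primeCompl p
  simp only at hπ
  have hu : IsUnit (algebraMap A (Localization.AtPrime P) t) := IsLocalization.map_units _ t
  have hpm : p ∈ IsLocalRing.maximalIdeal (Localization.AtPrime P) := by
    rw [hp]; exact Ideal.mem_span_singleton_self _
  refine ⟨π, ?_, fun a ha => ?_⟩
  · rw [← IsLocalization.AtPrime.to_map_mem_maximal_iff (Localization.AtPrime P) P, ← hπ]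
    exact Ideal.mul_mem_right _ _ hpm
  · rw [← IsLocalization.AtPrime.to_map_mem_maximal_iff (Localization.AtPrime P) P, hp,
      Ideal.mem_span_singleton] at ha
    obtain ⟨q, hq⟩ := ha
    obtain ⟨⟨b, r⟩, hb⟩ := IsLocalization.surj P.primeCompl q
    simp only at hb
    have key : algebraMap A (Localization.AtPrime P) (t * r * a) =
        algebraMap A (Localization.AtPrime P) (π * b) := by
      rw [map_mul, map_mul, map_mul, hq, ← hb, ← hπ]; ring
    obtain ⟨c, hc⟩ := (IsLocalization.eq_iff_exists P.primeCompl _).mp key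
    refine ⟨c * (t * r), (c * (t * r)).2, c * b, ?_⟩
    rw [mul_assoc, hc]; ring

theorem ringKrullDim_localization_le_one_of_mem_minimalPrimes {A : Type*} [CommRing A]
    [IsNoetherianRing A] {P : Ideal A} [P.IsPrime] {x : A}
    (h : P ∈ (Ideal.span {x}).minimalPrimes) : ringKrullDim (Localization.AtPrime P) ≤ 1 := by
  rw [IsLocalization.AtPrime.ringKrullDim_eq_height P]
  exact_mod_cast Ideal.height_le_one_of_isPrincipal_of_mem_minimalPrimes _ _ h

theorem isRegularLocal_of_notMem_of_pow_mul_mem {R S : Type*} [CommRing R] [CommRing S]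
    [IsDomain S] [UniqueFactorizationMonoid S] [Algebra R S] (A : Subalgebra R S)
    [IsNoetherianRing A] (x : A) (hx : ∀ f : S, ∃ N : ℕ, (x : S) ^ N * f ∈ A)
    (P : Ideal A) [P.IsPrime] (hP : ringKrullDim (Localization.AtPrime P) ≤ 1) (hxP : x ∉ P) :
    IsRegularLocal (Localization.AtPrime P) := by
  have hpow : ∀ N : ℕ, x ^ N ∉ P := fun N h => hxP (‹P.IsPrime›.mem_of_pow_mem N h)
  by_cases hb : P = ⊥
  · refine isRegularLocal_localization hP P.zero_mem fun a ha => ⟨1, ?_, 0, ?_⟩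
    · exact P.one_notMem
    · subst hb; simpa using ha
  let P' : Ideal S :=
    { carrier := {f | ∃ N : ℕ, ∃ a ∈ P, (a : S) = (x : S) ^ N * f}
      zero_mem' := ⟨0, 0, P.zero_mem, by simp⟩
      add_mem' := by
        rintro f g ⟨N, a, ha, hf⟩ ⟨M, b, hb, hg⟩
        refine ⟨N + M, x ^ M * a + x ^ N * b,
          P.add_mem (P.mul_mem_left _ ha) (P.mul_mem_left _ hb), ?_⟩
        push_cast
        rw [hf, hg]; ring
      smul_mem' := by
        rintro c f ⟨N, a, ha, hf⟩
        obtain ⟨M, hM⟩ := hx c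
        refine ⟨N + M, ⟨_, hM⟩ * a, P.mul_mem_left _ ha, ?_⟩
        push_cast
        rw [hf, smul_eq_mul]; ring }
  have hmemP' : ∀ a : A, (a : S) ∈ P' ↔ a ∈ P := by
    intro a
    constructor
    · rintro ⟨N, b, hb, hab⟩
      have : b = x ^ N * a := Subtype.ext (by push_cast; exact hab)
      rw [this] at hb
      exact (‹P.IsPrime›.mem_or_mem hb).resolve_left (hpow N)
    · exact fun ha => ⟨0, a, ha, by simp⟩
  have hprime : P'.IsPrime := by
    refine ⟨?_, ?_⟩
    · rw [Ideal.ne_top_iff_one]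
      intro h
      have := (hmemP' 1).mp (by simpa using h)
      exact P.one_notMem this
    · rintro f g ⟨N, a, ha, hfg⟩
      obtain ⟨M, hM⟩ := hx f
      obtain ⟨M', hM'⟩ := hx g
      have : x ^ (M + M') * a = x ^ N * ((⟨_, hM⟩ : A) * ⟨_, hM'⟩) := Subtype.ext (by
        push_cast
        rw [hfg]; ring)
      have h2 : x ^ N * ((⟨_, hM⟩ : A) * ⟨_, hM'⟩) ∈ P := this ▸ P.mul_mem_left _ ha
      have h3 := (‹P.IsPrime›.mem_or_mem h2).resolve_left (hpow N)
      rcases ‹P.IsPrime›.mem_or_mem h3 with h | h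
      · exact Or.inl ⟨M, _, h, rfl⟩
      · exact Or.inr ⟨M', _, h, rfl⟩
  have hne : P' ≠ ⊥ := by
    obtain ⟨a, ha, ha0⟩ := Submodule.exists_mem_ne_zero_of_ne_bot hb
    intro h
    have := (hmemP' a).mpr ha
    rw [h] at this
    exact ha0 (Subtype.ext (by simpa using this))
  obtain ⟨p, hpP', hp⟩ := hprime.exists_mem_prime_of_ne_bot hne
  obtain ⟨N, q, hqP, hq⟩ := hpP'
  have hspan : (Ideal.span {p}).IsPrime := (Ideal.span_singleton_prime hp.ne_zero).mpr hp
  have hx0 : (x : S) ≠ 0 := fun h => hxP (by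
    have : x = 0 := Subtype.ext (by simpa using h)
    rw [this]; exact P.zero_mem)
  have hq0 : (q : S) ≠ 0 := by
    rw [hq]; exact mul_ne_zero (pow_ne_zero _ hx0) hp.ne_zero
  have hcomap : Ideal.comap A.val (Ideal.span {p}) = P := by
    refine eq_of_le_of_ringKrullDim_localization_le_one hP ?_ ?_
    · intro a ha
      rw [Ideal.mem_comap, Ideal.mem_span_singleton'] at ha
      obtain ⟨c, hc⟩ := ha
      rw [← hmemP']
      change c * p = (a : S) at hc
      rw [← hc]
      exact P'.mul_mem_left _ ⟨N, q, hqP, hq⟩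
    · intro h
      have : q ∈ Ideal.comap A.val (Ideal.span {p}) := by
        rw [Ideal.mem_comap, Ideal.mem_span_singleton']
        exact ⟨_, hq.symm⟩
      rw [h] at this
      exact hq0 (by simpa using this)
  refine isRegularLocal_localization hP hqP fun a ha => ?_
  rw [← hcomap, Ideal.mem_comap, Ideal.mem_span_singleton] at ha
  obtain ⟨b, hb⟩ := ha
  change (a : S) = p * b at hb
  obtain ⟨M, hM⟩ := hx b
  refine ⟨x ^ (N + M), hpow _, ⟨_, hM⟩, Subtype.ext ?_⟩
  push_cast
  rw [hb, hq]; ring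

theorem gcd_lcm_div_eq_one {ι : Type*} [Fintype ι] [Nonempty ι] {lam ω : ι → ℕ} {L : ℕ}
    (hL : L = Finset.univ.lcm lam) (hL0 : 0 < L) (hω : ∀ i, lam i * ω i = L) :
    Finset.univ.gcd ω = 1 := by
  set g := Finset.univ.gcd ω with hg
  have hdvd : ∀ i, lam i * g ∣ L := fun i => by
    rw [← hω i]
    exact mul_dvd_mul_left _ (Finset.gcd_dvd (Finset.mem_univ i))
  obtain ⟨i₀⟩ := ‹Nonempty ι›
  obtain ⟨m, hm⟩ := (Dvd.intro_left _ rfl : g ∣ lam i₀ * g).trans (hdvd i₀)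
  have hg0 : 0 < g := Nat.pos_of_ne_zero fun h => by simp [h] at hm; omega
  have hLm : L ∣ m := by
    rw [hL]
    refine Finset.lcm_dvd fun i _ => ?_
    have := hdvd i
    rw [hm, mul_comm] at this
    exact Nat.dvd_of_mul_dvd_mul_left hg0 this
  have hm0 : 0 < m := Nat.pos_of_ne_zero fun h => by simp [h] at hm; omega
  have h1 : L ≤ m := Nat.le_of_dvd hm0 hLm
  nlinarith

theorem mem_closure_of_lcm_dvd {ι : Type*} [Fintype ι] [Nonempty ι] {lam ω : ι → ℕ} {L : ℕ}
    (hL0 : 0 < L) (hω : ∀ i, lam i * ω i = L) (hgcd : Finset.univ.gcd ω = 1)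
    {c : ι → ℤ} (hc : (L : ℤ) ∣ ∑ i, (ω i : ℤ) * c i) :
    c ∈ AddSubgroup.closure {b : ι → ℤ | ∃ β : ι →₀ ℕ, Finsupp.weight ω β = L ∧
      b = fun i => (β i : ℤ)} := by
  classical
  set G := AddSubgroup.closure {b : ι → ℤ | ∃ β : ι →₀ ℕ, Finsupp.weight ω β = L ∧
      b = fun i => (β i : ℤ)} with hG
  have hsub : ∀ β : ι →₀ ℕ, Finsupp.weight ω β = L → (fun i => (β i : ℤ)) ∈ G :=
    fun β hβ => AddSubgroup.subset_closure ⟨β, hβ, rfl⟩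
  have hlam : ∀ i, 0 < lam i := fun i => Nat.pos_of_ne_zero fun h => by
    have := hω i; rw [h] at this; omega
  have hpair : ∀ i j, (Pi.single i (ω j : ℤ) - Pi.single j (ω i : ℤ) : ι → ℤ) ∈ G := by
    intro i j
    obtain ⟨a, ha⟩ := Nat.gcd_dvd_left (lam i) (lam j)
    obtain ⟨b, hb⟩ := Nat.gcd_dvd_right (lam i) (lam j)
    have hg0 : 0 < (lam i).gcd (lam j) := Nat.gcd_pos_of_pos_left _ (hlam i)
    have hab : a.Coprime b := by
      have := Nat.coprime_div_gcd_div_gcd hg0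
      rwa [Nat.div_eq_of_eq_mul_right hg0 ha, Nat.div_eq_of_eq_mul_right hg0 hb] at this
    set g := (lam i).gcd (lam j) with hgdef
    have h1 : a * ω i = b * ω j := by
      have h := (hω i).trans (hω j).symm
      rw [ha, hb, mul_assoc, mul_assoc] at h
      exact Nat.eq_of_mul_eq_mul_left hg0 h
    obtain ⟨h, hh⟩ : a ∣ ω j := hab.dvd_of_dvd_mul_left (Dvd.intro _ h1)
    have ha0 : 0 < a := Nat.pos_of_ne_zero fun h => by have := hlam i; rw [ha, h] at this; omega
    have hi : ω i = b * h := by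
      rw [hh] at h1
      exact Nat.eq_of_mul_eq_mul_left ha0 (by rw [h1]; ring)
    obtain ⟨g', hg'⟩ : ∃ g', g = g' + 1 := ⟨g - 1, by omega⟩
    have e1 := hsub (Finsupp.single i a + Finsupp.single j (g' * b)) (by
      rw [map_add, Finsupp.weight_single, Finsupp.weight_single, ← hω j, hb, hg', smul_eq_mul,
        smul_eq_mul, h1]; ring)
    have e2 := hsub (Finsupp.single j (g * b)) (by
      rw [Finsupp.weight_single, ← hω j, hb, smul_eq_mul])
    have e3 := G.nsmul_mem (G.sub_mem e1 e2) h
    convert e3 using 1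
    ext l
    simp only [Pi.sub_apply, Pi.smul_apply, Finsupp.add_apply, nsmul_eq_mul,
      Finsupp.single_apply, Pi.single_apply, hh, hi, hg', @eq_comm _ l i, @eq_comm _ l j]
    split_ifs <;> push_cast <;> ring
  obtain ⟨d, hd⟩ := Finset.gcd_eq_sum_mul Finset.univ (fun i => (ω i : ℤ))
  have hd1 : ∑ i, (ω i : ℤ) * d i = 1 := by
    rw [← hd]
    have hdvd : (Finset.univ.gcd fun i => (ω i : ℤ)).natAbs ∣ Finset.univ.gcd ω :=
      Finset.dvd_gcd fun i _ => by
        have h : Finset.univ.gcd (fun i => (ω i : ℤ)) ∣ (ω i : ℤ) :=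
          Finset.gcd_dvd (Finset.mem_univ i)
        simpa using Int.natAbs_dvd_natAbs.mpr h
    rw [hgcd, Nat.dvd_one, ← Int.isUnit_iff_natAbs_eq] at hdvd
    rw [← Finset.normalize_gcd]
    exact normalize_eq_one.mpr hdvd
  have hker : ∀ c : ι → ℤ, ∑ i, (ω i : ℤ) * c i = 0 → c ∈ G := by
    intro c hc
    have : c = ∑ i, ∑ j, (d j * c i) • (Pi.single i (ω j : ℤ) - Pi.single j (ω i : ℤ) : ι → ℤ) := by
      ext l
      simp only [Finset.sum_apply, Pi.smul_apply, Pi.sub_apply, smul_eq_mul, mul_sub,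
        Finset.sum_sub_distrib, Pi.single_apply, mul_ite, mul_zero]
      have h1 : ∑ x, ∑ y, (if l = x then d y * c x * (ω y : ℤ) else 0) = c l := by
        rw [Finset.sum_eq_single l (fun b _ hb => by simp [hb.symm]) (by simp)]
        calc _ = (∑ y, (ω y : ℤ) * d y) * c l := by
              rw [Finset.sum_mul]
              exact Finset.sum_congr rfl fun y _ => by rw [if_pos rfl]; ring
          _ = c l := by rw [hd1, one_mul]
      have h2 : ∑ x, ∑ y, (if l = y then d y * c x * (ω x : ℤ) else 0) = 0 := by
        calc _ = d l * ∑ x, (ω x : ℤ) * c x := by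
              rw [Finset.mul_sum]
              exact Finset.sum_congr rfl fun x _ => by
                rw [Finset.sum_eq_single l (fun b _ hb => by simp [hb.symm]) (by simp),
                  if_pos rfl]
                ring
          _ = 0 := by rw [hc, mul_zero]
      rw [h1, h2, sub_zero]
    rw [this]
    exact G.sum_mem fun i _ => G.sum_mem fun j _ => G.zsmul_mem (hpair i j) _
  obtain ⟨j, hj⟩ := hc
  obtain ⟨i₀⟩ := ‹Nonempty ι›
  have e1 := hsub (Finsupp.single i₀ (lam i₀)) (by
      rw [Finsupp.weight_single, smul_eq_mul, hω])
  have e2 := hker (c - j • fun i => ((Finsupp.single i₀ (lam i₀) : ι →₀ ℕ) i : ℤ)) (by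
    simp only [Pi.sub_apply, Pi.smul_apply, smul_eq_mul, mul_sub, Finset.sum_sub_distrib, hj]
    rw [Finset.sum_eq_single i₀ (by intro b _ hb; simp [hb.symm]) (by simp)]
    simp only [Finsupp.single_eq_same]
    rw [← hω i₀]; push_cast; ring)
  simpa using G.add_mem e2 (G.zsmul_mem e1 j)

section ReesValuation

open Polynomial

variable {K ι : Type*} [Field K]

/-- The grading homomorphism sending the monomial `x ^ β * t ^ k` to itself times
`s ^ (ω·β - k * L)`, where `s` is the variable of the Hahn series. -/
noncomputable def reesGrading (ω : ι → ℕ) (L : ℕ) :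
    (MvPolynomial ι K)[X] →+* HahnSeries ℤ (MvPolynomial ι K)[X] :=
  Polynomial.eval₂RingHom
    (MvPolynomial.eval₂Hom (HahnSeries.C.comp (Polynomial.C.comp MvPolynomial.C))
      (fun i => HahnSeries.single (ω i : ℤ) (Polynomial.C (MvPolynomial.X i))))
    (HahnSeries.single (-(L : ℤ)) Polynomial.X)

/-- The monomial valuation on `K[x][t]` with `x i ↦ ω i` and `t ↦ -L`. -/
noncomputable def reesValuation (ω : ι → ℕ) (L : ℕ) :
    AddValuation (MvPolynomial ι K)[X] (WithTop ℤ) :=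
  (HahnSeries.addVal ℤ (MvPolynomial ι K)[X]).comap (reesGrading ω L)

variable {ω : ι → ℕ} {L : ℕ}

theorem reesGrading_monomial (k : ℕ) (β : ι →₀ ℕ) (c : K) :
    reesGrading ω L (monomial k (MvPolynomial.monomial β c)) =
      HahnSeries.single ((Finsupp.weight ω β : ℤ) - k * L)
        (monomial k (MvPolynomial.monomial β c)) := by
  have h1 : ∀ β : ι →₀ ℕ, (β.prod fun i m =>
      (HahnSeries.single (ω i : ℤ) (C (MvPolynomial.X i) : (MvPolynomial ι K)[X])) ^ m) =
      HahnSeries.single (Finsupp.weight ω β : ℤ) (C (MvPolynomial.monomial β 1)) := by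
    intro β
    induction β using Finsupp.induction_linear with
    | zero => simp
    | add f g hf hg =>
      rw [Finsupp.prod_add_index' (by simp) (by intros; rw [pow_add]), hf, hg,
        HahnSeries.single_mul_single, ← C_mul, MvPolynomial.monomial_mul]
      simp
    | single i m =>
      rw [Finsupp.prod_single_index (by simp), HahnSeries.single_pow, ← C_pow,
        MvPolynomial.X_pow_eq_monomial, Finsupp.weight_single]
      simp
  rw [reesGrading, coe_eval₂RingHom, eval₂_monomial, MvPolynomial.coe_eval₂Hom,
    MvPolynomial.eval₂_monomial, h1, HahnSeries.single_pow, RingHom.comp_apply,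
    HahnSeries.C_apply, HahnSeries.single_mul_single, HahnSeries.single_mul_single,
    RingHom.comp_apply, ← C_mul, MvPolynomial.C_mul_monomial, C_mul_X_pow_eq_monomial]
  congr 1
  · simp [sub_eq_add_neg]
  · simp

theorem coeff_reesGrading (f : (MvPolynomial ι K)[X]) (m : ℤ) (k : ℕ) (β : ι →₀ ℕ) :
    (((reesGrading ω L f).coeff m).coeff k).coeff β =
      if (Finsupp.weight ω β : ℤ) - k * L = m then (f.coeff k).coeff β else 0 := by
  classical
  induction f using Polynomial.induction_on' with
  | add p q hp hq =>
    rw [map_add, HahnSeries.coeff_add, Polynomial.coeff_add, MvPolynomial.coeff_add, hp, hq,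
      Polynomial.coeff_add, MvPolynomial.coeff_add]
    split_ifs <;> simp
  | monomial j r =>
    induction r using MvPolynomial.induction_on' with
    | add p q hp hq =>
      rw [map_add, map_add, HahnSeries.coeff_add, Polynomial.coeff_add, MvPolynomial.coeff_add,
        hp, hq, Polynomial.coeff_add, MvPolynomial.coeff_add]
      split_ifs <;> simp
    | monomial γ c =>
      rw [reesGrading_monomial, HahnSeries.coeff_single]
      by_cases hj : j = k
      · subst hj
        by_cases hγ : γ = β
        · subst hγ
          split_ifs <;> simp_all
        · split_ifs <;> simp [MvPolynomial.coeff_monomial, hγ]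
      · split_ifs <;> simp [coeff_monomial, hj]

theorem reesValuation_le_of_coeff_ne_zero {f : (MvPolynomial ι K)[X]} {k : ℕ} {β : ι →₀ ℕ}
    (h : (f.coeff k).coeff β ≠ 0) :
    reesValuation ω L f ≤ (((Finsupp.weight ω β : ℤ) - k * L : ℤ) : WithTop ℤ) := by
  refine HahnSeries.addVal_le_of_coeff_ne_zero fun h0 => h ?_
  have := coeff_reesGrading (ω := ω) (L := L) f ((Finsupp.weight ω β : ℤ) - k * L) k β
  rw [h0] at this
  simpa using this.symm

theorem exists_reesValuation_eq {f : (MvPolynomial ι K)[X]} (hf : f ≠ 0) :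
    ∃ k β, (f.coeff k).coeff β ≠ 0 ∧
      reesValuation ω L f = (((Finsupp.weight ω β : ℤ) - k * L : ℤ) : WithTop ℤ) := by
  have hne : ∀ {g : (MvPolynomial ι K)[X]}, g ≠ 0 → ∃ k β, (g.coeff k).coeff β ≠ 0 := by
    intro g hg
    by_contra! h
    exact hg (Polynomial.ext fun k => MvPolynomial.ext _ _ fun β => by simpa using h k β)
  have hg : reesGrading ω L f ≠ 0 := by
    obtain ⟨k, β, h⟩ := hne hf
    intro h0
    have := coeff_reesGrading (ω := ω) (L := L) f ((Finsupp.weight ω β : ℤ) - k * L) k β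
    rw [h0] at this
    exact h (by simpa using this.symm)
  obtain ⟨k, β, h⟩ := hne (HahnSeries.coeff_order_eq_zero.not.mpr hg)
  rw [coeff_reesGrading] at h
  split_ifs at h with hm
  · refine ⟨k, β, h, ?_⟩
    change HahnSeries.addVal ℤ _ (reesGrading ω L f) = _
    rw [HahnSeries.addVal_apply_of_ne hg, hm]
  · exact absurd rfl h

theorem reesValuation_monomial (k : ℕ) (β : ι →₀ ℕ) {c : K} (hc : c ≠ 0) :
    reesValuation ω L (monomial k (MvPolynomial.monomial β c)) =
      (((Finsupp.weight ω β : ℤ) - k * L : ℤ) : WithTop ℤ) := by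
  change HahnSeries.addVal ℤ _ (reesGrading ω L _) = _
  rw [reesGrading_monomial, HahnSeries.addVal_apply_of_ne (by simp [hc]),
    HahnSeries.order_single (by simp [hc])]

end ReesValuation

section ReesSupport

open Polynomial

variable {K ι : Type*} [Field K]

theorem mem_of_mem_reesAlgebra_of_coeff_ne_zero {I : Ideal (MvPolynomial ι K)}
    (S : AddSubmonoid (ℕ × (ι →₀ ℕ))) (h0 : ∀ β, (0, β) ∈ S)
    (h1 : ∀ r ∈ I, ∀ β, r.coeff β ≠ 0 → (1, β) ∈ S)
    {f : (MvPolynomial ι K)[X]} (hf : f ∈ reesAlgebra I) {k : ℕ} {β : ι →₀ ℕ}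
    (h : (f.coeff k).coeff β ≠ 0) : (k, β) ∈ S := by
  classical
  let B : Subalgebra (MvPolynomial ι K) (MvPolynomial ι K)[X] :=
    { carrier := {f | ∀ k β, (f.coeff k).coeff β ≠ 0 → (k, β) ∈ S}
      mul_mem' := by
        intro f g hf hg k β h
        rw [Polynomial.coeff_mul, MvPolynomial.coeff_sum] at h
        obtain ⟨⟨k₁, k₂⟩, hk, h⟩ := Finset.exists_ne_zero_of_sum_ne_zero h
        rw [MvPolynomial.coeff_mul] at h
        obtain ⟨⟨β₁, β₂⟩, hβ, h⟩ := Finset.exists_ne_zero_of_sum_ne_zero h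
        rw [Finset.HasAntidiagonal.mem_antidiagonal] at hk hβ
        have := S.add_mem (hf k₁ β₁ (left_ne_zero_of_mul h)) (hg k₂ β₂ (right_ne_zero_of_mul h))
        rwa [Prod.mk_add_mk, hk, hβ] at this
      add_mem' := by
        intro f g hf hg k β h
        rw [Polynomial.coeff_add, MvPolynomial.coeff_add] at h
        by_cases hf0 : (f.coeff k).coeff β = 0
        · exact hg k β (by simpa [hf0] using h)
        · exact hf k β hf0
      algebraMap_mem' := by
        intro r k β h
        rw [Polynomial.algebraMap_apply, Algebra.algebraMap_self_apply, Polynomial.coeff_C] at h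
        split_ifs at h with hk
        · rw [hk]; exact h0 β
        · exact absurd rfl h }
  have hle : reesAlgebra I ≤ B := by
    rw [← adjoin_monomial_eq_reesAlgebra, Algebra.adjoin_le_iff]
    rintro _ ⟨r, hr, rfl⟩ k β h
    rw [Polynomial.coeff_monomial] at h
    split_ifs at h with hk
    · rw [← hk]; exact h1 r hr β h
    · exact absurd rfl h
  exact hle hf k β h

theorem Subalgebra.mem_ideal_of_forall_monomial_mem
    {A : Subalgebra (MvPolynomial ι K) (MvPolynomial ι K)[X]} {T : Ideal A} {f : A}
    (h : ∀ k β, ((f : (MvPolynomial ι K)[X]).coeff k).coeff β ≠ 0 → ∃ a ∈ T,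
      (a : (MvPolynomial ι K)[X]) =
        monomial k (MvPolynomial.monomial β (((f : (MvPolynomial ι K)[X]).coeff k).coeff β))) :
    f ∈ T := by
  have key : (f : (MvPolynomial ι K)[X]) ∈ T.toAddSubmonoid.map A.val := by
    rw [(f : (MvPolynomial ι K)[X]).as_sum_support]
    refine sum_mem fun k _ => ?_
    rw [((f : (MvPolynomial ι K)[X]).coeff k).as_sum, map_sum]
    refine sum_mem fun β hβ => ?_
    obtain ⟨a, ha, hfa⟩ := h k β (MvPolynomial.mem_support_iff.mp hβ)
    exact ⟨a, ha, hfa⟩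
  obtain ⟨a, ha, hfa⟩ := key
  obtain rfl : a = f := Subtype.ext hfa
  exact ha

theorem monomial_smul_mem_pow_weight [Fintype ι] {lam ω : ι → ℕ} {L : ℕ}
    (hω : ∀ i, lam i * ω i = L) {J : Ideal (MvPolynomial ι K)}
    (hJ : ∀ i, MvPolynomial.X i ^ lam i ∈ J) (β : ι →₀ ℕ) :
    MvPolynomial.monomial (L • β) (1 : K) ∈ J ^ Finsupp.weight ω β := by
  have h1 : MvPolynomial.monomial (L • β) (1 : K) =
      ∏ i, (MvPolynomial.X i ^ lam i) ^ (β i * ω i) := by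
    rw [MvPolynomial.monomial_eq, Finsupp.prod_fintype _ _ (by simp)]
    simp only [map_one, one_mul, Finsupp.smul_apply, smul_eq_mul]
    refine Finset.prod_congr rfl fun i _ => ?_
    rw [← pow_mul, ← hω i]
    congr 1
    ring
  have h2 : Finsupp.weight ω β = ∑ i, β i * ω i := by
    rw [Finsupp.weight_apply, Finsupp.sum_fintype _ _ (by simp)]
    simp
  rw [h1, h2, ← Finset.prod_pow_eq_pow_sum]
  exact Ideal.prod_mem_prod fun i _ => Ideal.pow_mem_pow (hJ i) _

theorem le_weight_of_mem_pow {J : Ideal (MvPolynomial ι K)} {ω : ι → ℕ} {L : ℕ}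
    (hJ : ∀ r ∈ J, ∀ β, r.coeff β ≠ 0 → L ≤ Finsupp.weight ω β) {k : ℕ} {r : MvPolynomial ι K}
    (hr : r ∈ J ^ k) {β : ι →₀ ℕ} (hβ : r.coeff β ≠ 0) : k * L ≤ Finsupp.weight ω β := by
  let S : AddSubmonoid (ℕ × (ι →₀ ℕ)) :=
    { carrier := {p | p.1 * L ≤ Finsupp.weight ω p.2}
      zero_mem' := by simp
      add_mem' := by
        intro p q hp hq
        simp only [Set.mem_ofPred_eq, Prod.fst_add, Prod.snd_add, map_add, add_mul] at hp hq ⊢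
        omega }
  refine mem_of_mem_reesAlgebra_of_coeff_ne_zero (I := J) S (fun β => ?_)
    (fun r hr β hβ => ?_) (f := monomial k r) (reesAlgebra.monomial_mem.mpr hr) (by simpa using hβ)
  · change 0 * L ≤ _
    simp
  · change 1 * L ≤ _
    simpa using hJ r hr β hβ

theorem idealIntegral_of_isIntegral_monomial {R : Type*} [CommRing R] {J : Ideal R} {x : R}
    (h : IsIntegral (reesAlgebra J) (monomial 1 x : R[X])) : IdealIntegral J x := by
  cases subsingleton_or_nontrivial R
  · exact ⟨1, one_pos, fun _ => 0, fun _ _ => zero_mem _, Subsingleton.elim _ _⟩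
  · obtain ⟨p, hp, hpx⟩ := h
    set m := p.natDegree with hm
    have hsum : x ^ m + ∑ i ∈ Finset.range m, (p.coeff i : R[X]).coeff (m - i) * x ^ i = 0 := by
      have h1 := congrArg (fun q : R[X] => q.coeff m) hpx
      rw [hp.as_sum, eval₂_add, eval₂_pow, eval₂_X, eval₂_finsetSum] at h1
      simp only [eval₂_mul, eval₂_C, eval₂_pow, eval₂_X, Polynomial.coeff_add, finsetSum_coeff,
        monomial_pow, one_mul, coeff_monomial, if_true, coeff_zero, ← hm] at h1
      rw [← h1]
      congr 1
      refine Finset.sum_congr rfl fun i hi => ?_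
      have hi' : m = (m - i) + i := by have := Finset.mem_range.mp hi; omega
      conv_rhs => rw [hi', coeff_mul_monomial]
      rfl
    refine ⟨m, Nat.pos_of_ne_zero fun h0 => ?_, fun j => (p.coeff (m - j) : R[X]).coeff j,
      fun j _ => (p.coeff (m - j)).2 j, ?_⟩
    · rw [h0] at hsum
      simp at hsum
    · rw [← hsum]
      congr 1
      refine Finset.sum_nbij' (fun j => m - j) (fun i => m - i) ?_ ?_ ?_ ?_ ?_
      · intro j hj; simp at hj ⊢; omega
      · intro j hj; simp at hj ⊢; omega
      · intro j hj; simp at hj ⊢; omega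
      · intro j hj; simp at hj ⊢; omega
      · intro j hj
        have : m - (m - j) = j := by simp at hj; omega
        simp only [this]

theorem idealIntegral_span_X_pow_iff [Fintype ι] {lam ω : ι → ℕ} {L : ℕ} (hL0 : 0 < L)
    (hω : ∀ i, lam i * ω i = L) (x : MvPolynomial ι K) :
    IdealIntegral (Ideal.span (Set.range fun i => (MvPolynomial.X i : MvPolynomial ι K) ^ lam i)) x
      ↔ ∀ β, x.coeff β ≠ 0 → L ≤ Finsupp.weight ω β := by
  set J := Ideal.span (Set.range fun i => (MvPolynomial.X i : MvPolynomial ι K) ^ lam i) with hJ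
  have hXJ : ∀ i, MvPolynomial.X i ^ lam i ∈ J := fun i => Ideal.subset_span ⟨i, rfl⟩
  have hJL : ∀ r ∈ J, ∀ β, r.coeff β ≠ 0 → L ≤ Finsupp.weight ω β := by
    intro r hr β hβ
    have : J = Ideal.span ((fun s => MvPolynomial.monomial s (1 : K)) ''
        Set.range fun i => Finsupp.single i (lam i)) := by
      rw [hJ, ← Set.range_comp]
      simp only [Function.comp_def, MvPolynomial.X_pow_eq_monomial]
    rw [this, MvPolynomial.mem_ideal_span_monomial_image] at hr
    obtain ⟨_, ⟨i, rfl⟩, hle⟩ := hr β (MvPolynomial.mem_support_iff.mpr hβ)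
    obtain ⟨γ, rfl⟩ := exists_add_of_le hle
    rw [map_add, Finsupp.weight_single, smul_eq_mul, hω]
    exact Nat.le_add_right _ _
  constructor
  · rintro ⟨m, hm, a, ha, hsum⟩ β hβ
    by_contra! hlt
    let v := (reesValuation (K := K) ω L).comap (C : MvPolynomial ι K →+* _)
    have hv : ∀ r : MvPolynomial ι K, v r = reesValuation ω L (C r) := fun r => rfl
    have hx0 : (C x : (MvPolynomial ι K)[X]) ≠ 0 := by
      intro h
      rw [C_eq_zero] at h
      exact hβ (by simp [h])
    obtain ⟨k, γ, hγ, hu⟩ := exists_reesValuation_eq (ω := ω) (L := L) hx0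
    have hvx := reesValuation_le_of_coeff_ne_zero (ω := ω) (L := L) (f := C x) (k := 0) (β := β)
      (by simpa using hβ)
    set u : ℤ := (Finsupp.weight ω γ : ℤ) - k * L with hudef
    rw [hu] at hvx
    have huL : u < L := by
      have : u ≤ (Finsupp.weight ω β : ℤ) - (0 : ℕ) * L := by exact_mod_cast hvx
      simp at this
      omega
    have hpow : ∀ e : ℕ, v (x ^ e) = ((e * u : ℤ) : WithTop ℤ) := by
      intro e
      rw [AddValuation.map_pow, hv, hu, ← WithTop.coe_nsmul, nsmul_eq_mul]
    have hterm : ∀ j ∈ Finset.Icc 1 m, ((m * u : ℤ) : WithTop ℤ) < v (a j * x ^ (m - j)) := by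
      intro j hj
      have hj' := Finset.mem_Icc.mp hj
      rw [AddValuation.map_mul, hpow]
      by_cases haj : a j = 0
      · rw [haj, AddValuation.map_zero, top_add]
        exact WithTop.coe_lt_top _
      · obtain ⟨k', δ, hδ, hw⟩ := exists_reesValuation_eq (ω := ω) (L := L)
          (f := C (a j)) (by simpa using haj)
        rw [coeff_C] at hδ
        split_ifs at hδ with hk'
        · rw [hv, hw, ← WithTop.coe_add, WithTop.coe_lt_coe, hk']
          have h1 := le_weight_of_mem_pow hJL (ha j hj) hδ
          have h2 : (j * L : ℤ) ≤ Finsupp.weight ω δ := by exact_mod_cast h1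
          have h3 : (j : ℤ) * u < j * L := by
            apply mul_lt_mul_of_pos_left huL
            exact_mod_cast hj'.1
          rw [Nat.cast_sub hj'.2]
          push_cast
          linarith
        · exact absurd rfl hδ
    have h1 : ((m * u : ℤ) : WithTop ℤ) < v (∑ j ∈ Finset.Icc 1 m, a j * x ^ (m - j)) :=
      AddValuation.map_lt_sum v WithTop.coe_ne_top hterm
    rw [← neg_eq_of_add_eq_zero_right hsum, AddValuation.map_neg, hpow] at h1
    exact lt_irrefl _ h1
  · intro h
    refine idealIntegral_of_isIntegral_monomial ?_
    rw [x.as_sum, map_sum]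
    refine IsIntegral.sum _ fun β hβ => IsIntegral.of_pow hL0 ?_
    have hmem : monomial (1 * L) (MvPolynomial.monomial β (x.coeff β) ^ L) ∈ reesAlgebra J := by
      rw [reesAlgebra.monomial_mem, one_mul, MvPolynomial.monomial_pow,
        ← mul_one (x.coeff β ^ L), ← MvPolynomial.C_mul_monomial]
      exact Ideal.mul_mem_left _ _ (Ideal.pow_le_pow_right (h β (MvPolynomial.mem_support_iff.mp hβ))
        (monomial_smul_mem_pow_weight hω hXJ β))
    rw [monomial_pow]
    exact isIntegral_algebraMap (x := (⟨_, hmem⟩ : reesAlgebra J))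

end ReesSupport

section ReesCenter

open Polynomial

variable {K ι : Type*} [Field K] {ω : ι → ℕ} {L : ℕ} {I : Ideal (MvPolynomial ι K)}

theorem reesValuation_nonneg (hI : ∀ r, r ∈ I ↔ ∀ β, r.coeff β ≠ 0 → L ≤ Finsupp.weight ω β)
    (f : reesAlgebra I) : 0 ≤ reesValuation ω L (f : (MvPolynomial ι K)[X]) := by
  by_cases hf : (f : (MvPolynomial ι K)[X]) = 0
  · rw [hf, AddValuation.map_zero]
    exact le_top
  · obtain ⟨k, β, hβ, hv⟩ := exists_reesValuation_eq (ω := ω) (L := L) hf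
    have := le_weight_of_mem_pow (fun r => (hI r).mp) (f.2 k) hβ
    have h2 : (k * L : ℤ) ≤ Finsupp.weight ω β := by exact_mod_cast this
    rw [hv]
    exact_mod_cast sub_nonneg.mpr h2

theorem monomial_mem (hI : ∀ r, r ∈ I ↔ ∀ β, r.coeff β ≠ 0 → L ≤ Finsupp.weight ω β)
    {β : ι →₀ ℕ} (hβ : L ≤ Finsupp.weight ω β) : MvPolynomial.monomial β (1 : K) ∈ I := by
  classical
  rw [hI]
  intro γ hγ
  rw [MvPolynomial.coeff_monomial] at hγ
  split_ifs at hγ with h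
  · rwa [← h]
  · exact absurd rfl hγ

theorem X_pow_mem (hI : ∀ r, r ∈ I ↔ ∀ β, r.coeff β ≠ 0 → L ≤ Finsupp.weight ω β)
    {lam : ι → ℕ} (hω : ∀ i, lam i * ω i = L) (i : ι) :
    (MvPolynomial.X i : MvPolynomial ι K) ^ lam i ∈ I := by
  rw [MvPolynomial.X_pow_eq_monomial]
  refine monomial_mem hI ?_
  rw [Finsupp.weight_single, smul_eq_mul, hω]

theorem monomial_mem_pow (hI : ∀ r, r ∈ I ↔ ∀ β, r.coeff β ≠ 0 → L ≤ Finsupp.weight ω β)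
    {k : ℕ} {r : MvPolynomial ι K} (hr : r ∈ I ^ k) {β : ι →₀ ℕ} (hβ : r.coeff β ≠ 0) :
    MvPolynomial.monomial β (1 : K) ∈ I ^ k := by
  let S : AddSubmonoid (ℕ × (ι →₀ ℕ)) :=
    { carrier := {p | MvPolynomial.monomial p.2 (1 : K) ∈ I ^ p.1}
      zero_mem' := by simp
      add_mem' := by
        intro p q hp hq
        have := Ideal.mul_mem_mul hp hq
        rwa [← pow_add, MvPolynomial.monomial_mul, one_mul] at this }
  refine mem_of_mem_reesAlgebra_of_coeff_ne_zero (I := I) S (fun β => ?_)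
    (fun r hr β hβ => ?_) (f := monomial k r) (reesAlgebra.monomial_mem.mpr hr) (by simpa using hβ)
  · change _ ∈ I ^ 0
    simp
  · change _ ∈ I ^ 1
    rw [pow_one]
    exact monomial_mem hI ((hI r).mp hr β hβ)

theorem exists_monomial_mem_pow_of_mem_closure
    (hI : ∀ r, r ∈ I ↔ ∀ β, r.coeff β ≠ 0 → L ≤ Finsupp.weight ω β)
    {c : ι → ℤ}
    (hc : c ∈ AddSubgroup.closure {b : ι → ℤ | ∃ β : ι →₀ ℕ, Finsupp.weight ω β = L ∧
      b = fun i => (β i : ℤ)}) :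
    ∃ (k k' : ℕ) (s s' : ι →₀ ℕ), Finsupp.weight ω s = k * L ∧ Finsupp.weight ω s' = k' * L ∧
      MvPolynomial.monomial s (1 : K) ∈ I ^ k ∧ MvPolynomial.monomial s' (1 : K) ∈ I ^ k' ∧
      ∀ i, c i + s i = s' i := by
  induction hc using AddSubgroup.closure_induction with
  | mem b hb =>
    obtain ⟨β, hβ, rfl⟩ := hb
    exact ⟨0, 1, 0, β, by simp, by simpa using hβ, by simp,
      by simpa using monomial_mem hI hβ.ge, by simp⟩
  | zero => exact ⟨0, 0, 0, 0, by simp, by simp, by simp, by simp, by simp⟩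
  | neg b _ ih =>
    obtain ⟨k, k', s, s', h1, h2, h3, h4, h5⟩ := ih
    exact ⟨k', k, s', s, h2, h1, h4, h3, fun i => by simp [← h5 i]⟩
  | add b d _ _ ihb ihd =>
    obtain ⟨k, k', s, s', h1, h2, h3, h4, h5⟩ := ihb
    obtain ⟨j, j', r, r', g1, g2, g3, g4, g5⟩ := ihd
    refine ⟨k + j, k' + j', s + r, s' + r', by rw [map_add, h1, g1, add_mul],
      by rw [map_add, h2, g2, add_mul], ?_, ?_, fun i => ?_⟩
    · have := Ideal.mul_mem_mul h3 g3
      rwa [← pow_add, MvPolynomial.monomial_mul, one_mul] at this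
    · have := Ideal.mul_mem_mul h4 g4
      rwa [← pow_add, MvPolynomial.monomial_mul, one_mul] at this
    · have := h5 i
      have := g5 i
      simp only [Pi.add_apply, Finsupp.add_apply, Nat.cast_add]
      omega

theorem isRegularLocal_of_algebraMap_X_notMem
    (hI : ∀ r, r ∈ I ↔ ∀ β, r.coeff β ≠ 0 → L ≤ Finsupp.weight ω β)
    {lam : ι → ℕ} (hω : ∀ i, lam i * ω i = L)
    [Finite ι] {P : Ideal (reesAlgebra I)} [P.IsPrime] (hP : ringKrullDim (Localization.AtPrime P) ≤ 1)
    {i : ι} (hi : algebraMap (MvPolynomial ι K) (reesAlgebra I) (MvPolynomial.X i) ∉ P) :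
    IsRegularLocal (Localization.AtPrime P) := by
  refine isRegularLocal_of_notMem_of_pow_mul_mem (reesAlgebra I) _ (fun f => ?_) P hP hi
  refine ⟨lam i * f.natDegree, fun k => ?_⟩
  change ((C (MvPolynomial.X i)) ^ _ * f).coeff k ∈ _
  rw [← C_pow, coeff_C_mul]
  rcases le_or_gt k f.natDegree with h | h
  · refine Ideal.mul_mem_right _ _ (Ideal.pow_le_pow_right h ?_)
    rw [pow_mul]
    exact Ideal.pow_mem_pow (X_pow_mem hI hω i) _
  · rw [coeff_eq_zero_of_natDegree_lt h, mul_zero]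
    exact Ideal.zero_mem _

/-- The center on the Rees algebra of the monomial valuation `reesValuation ω L`. -/
def reesCenter (hI : ∀ r, r ∈ I ↔ ∀ β, r.coeff β ≠ 0 → L ≤ Finsupp.weight ω β) :
    Ideal (reesAlgebra I) where
  carrier := {f | 0 < reesValuation ω L (f : (MvPolynomial ι K)[X])}
  zero_mem' := by
    change 0 < reesValuation ω L (0 : (MvPolynomial ι K)[X])
    rw [AddValuation.map_zero]
    exact WithTop.coe_lt_top 0
  add_mem' {f g} hf hg := by
    change 0 < reesValuation ω L ((f : (MvPolynomial ι K)[X]) + (g : (MvPolynomial ι K)[X]))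
    exact AddValuation.map_lt_add _ hf hg
  smul_mem' c f hf := by
    change 0 < reesValuation ω L ((c : (MvPolynomial ι K)[X]) * (f : (MvPolynomial ι K)[X]))
    rw [AddValuation.map_mul]
    exact lt_of_lt_of_le hf (le_add_of_nonneg_left (reesValuation_nonneg hI c))

variable (hI : ∀ r, r ∈ I ↔ ∀ β, r.coeff β ≠ 0 → L ≤ Finsupp.weight ω β)

theorem mem_reesCenter {f : reesAlgebra I} :
    f ∈ reesCenter hI ↔ 0 < reesValuation ω L (f : (MvPolynomial ι K)[X]) :=
  Iff.rfl

theorem notMem_reesCenter {f : reesAlgebra I} :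
    f ∉ reesCenter hI ↔ reesValuation ω L (f : (MvPolynomial ι K)[X]) = 0 := by
  rw [mem_reesCenter, not_lt]
  exact ⟨fun h => le_antisymm h (reesValuation_nonneg hI f), fun h => h.le⟩

instance reesCenter_isPrime : (reesCenter hI).IsPrime where
  ne_top' := by
    rw [Ideal.ne_top_iff_one, notMem_reesCenter]
    exact AddValuation.map_one _
  mem_or_mem' {f g} h := by
    by_contra! hfg
    rw [notMem_reesCenter, notMem_reesCenter] at hfg
    rw [mem_reesCenter] at h
    change 0 < reesValuation ω L ((f : (MvPolynomial ι K)[X]) * (g : (MvPolynomial ι K)[X])) at h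
    rw [AddValuation.map_mul, hfg.1, hfg.2, add_zero] at h
    exact lt_irrefl _ h

theorem algebraMap_X_mem_reesCenter (hpos : ∀ i, 0 < ω i) (i : ι) :
    algebraMap (MvPolynomial ι K) (reesAlgebra I) (MvPolynomial.X i) ∈ reesCenter hI := by
  rw [mem_reesCenter]
  change 0 < reesValuation ω L (monomial 0 (MvPolynomial.monomial (Finsupp.single i 1) (1 : K)))
  rw [reesValuation_monomial _ _ one_ne_zero, Finsupp.weight_single]
  have := hpos i
  exact_mod_cast (by simpa using this : (0 : ℤ) < ((1 • ω i : ℕ) : ℤ) - (0 : ℕ) * L)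

variable [Fintype ι] {lam : ι → ℕ}

theorem reesCenter_le (hL0 : 0 < L) (hω : ∀ i, lam i * ω i = L)
    {P : Ideal (reesAlgebra I)} [P.IsPrime]
    (hX : ∀ i, algebraMap (MvPolynomial ι K) (reesAlgebra I) (MvPolynomial.X i) ∈ P) :
    reesCenter hI ≤ P := by
  have hIP : I ≤ P.comap (algebraMap (MvPolynomial ι K) (reesAlgebra I)) := by
    intro r hr
    have h1 : r ∈ Ideal.span (MvPolynomial.X '' Set.univ : Set (MvPolynomial ι K)) := by
      rw [MvPolynomial.mem_ideal_span_X_image]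
      intro β hβ
      by_contra! h0
      have : β = 0 := Finsupp.ext fun i => h0 i trivial
      have := (hI r).mp hr β (MvPolynomial.mem_support_iff.mp hβ)
      simp_all
    refine (Ideal.span_le.mpr ?_ : Ideal.span _ ≤ _) h1
    rintro _ ⟨i, -, rfl⟩
    exact hX i
  intro f hf
  refine Subalgebra.mem_ideal_of_forall_monomial_mem fun k β hβ => ?_
  set c := ((f : (MvPolynomial ι K)[X]).coeff k).coeff β with hc
  have hlt : k * L + 1 ≤ Finsupp.weight ω β := by
    have h1 := lt_of_lt_of_le ((mem_reesCenter hI).mp hf)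
      (reesValuation_le_of_coeff_ne_zero (ω := ω) (L := L) hβ)
    have h2 : (0 : ℤ) < (Finsupp.weight ω β : ℤ) - k * L := by exact_mod_cast h1
    zify
    linarith
  have hmul : ∀ r ∈ I * I ^ (k * L), ∃ b ∈ P, (b : (MvPolynomial ι K)[X]) = monomial (k * L) r := by
    intro r hr
    induction hr using Submodule.mul_induction_on' with
    | mem_mul_mem r hr s hs =>
      refine ⟨algebraMap (MvPolynomial ι K) (reesAlgebra I) r * ⟨_, reesAlgebra.monomial_mem.mpr hs⟩,
        P.mul_mem_right _ (hIP hr), ?_⟩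
      change C r * monomial (k * L) s = _
      rw [C_mul_monomial]
    | add r _ s _ hr hs =>
      obtain ⟨a, ha, hra⟩ := hr
      obtain ⟨b, hb, hsb⟩ := hs
      exact ⟨a + b, P.add_mem ha hb, by push_cast; rw [hra, hsb, map_add]⟩
  have hmem : monomial k (MvPolynomial.monomial β c) ∈ reesAlgebra I := by
    rw [reesAlgebra.monomial_mem, ← mul_one c, ← MvPolynomial.C_mul_monomial]
    exact Ideal.mul_mem_left _ _ (monomial_mem_pow hI (f.2 k) hβ)
  refine ⟨⟨_, hmem⟩, ?_, rfl⟩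
  refine ‹P.IsPrime›.mem_of_pow_mem L ?_
  obtain ⟨b, hb, hbL⟩ := hmul (MvPolynomial.monomial β c ^ L) (by
    rw [MvPolynomial.monomial_pow, ← mul_one (c ^ L), ← MvPolynomial.C_mul_monomial,
      mul_comm I, ← pow_succ]
    exact Ideal.mul_mem_left _ _ (Ideal.pow_le_pow_right hlt
      (monomial_smul_mem_pow_weight hω (X_pow_mem hI hω) β)))
  convert hb
  refine Subtype.ext ?_
  rw [hbL]
  push_cast
  rw [monomial_pow]

theorem ringKrullDim_localization_reesCenter_le_one [Nonempty ι] (hL0 : 0 < L)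
    (hω : ∀ i, lam i * ω i = L) :
    ringKrullDim (Localization.AtPrime (reesCenter hI)) ≤ 1 := by
  obtain ⟨i₀⟩ := ‹Nonempty ι›
  have hpos : ∀ i, 0 < ω i := fun i => Nat.pos_of_ne_zero fun h => by
    have := hω i; rw [h] at this; omega
  have hU : ∀ i, monomial 1 (MvPolynomial.X i ^ lam i) ∈ reesAlgebra I := fun i => by
    rw [reesAlgebra.monomial_mem, pow_one]; exact X_pow_mem hI hω i
  have hmin : reesCenter hI ∈
      (Ideal.span {algebraMap (MvPolynomial ι K) (reesAlgebra I) (MvPolynomial.X i₀)}).minimalPrimes := by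
    refine ⟨⟨inferInstance, ?_⟩, fun P ⟨hP, hxP⟩ hPQ => ?_⟩
    · rw [Ideal.span_singleton_le_iff_mem]
      exact algebraMap_X_mem_reesCenter hI hpos i₀
    · rw [Ideal.span_singleton_le_iff_mem] at hxP
      refine reesCenter_le hI hL0 hω fun i => ?_
      have hprod : (⟨_, hU i₀⟩ : reesAlgebra I) *
          algebraMap (MvPolynomial ι K) (reesAlgebra I) (MvPolynomial.X i) ^ lam i ∈ P := by
        have : (⟨_, hU i₀⟩ : reesAlgebra I) *
            algebraMap (MvPolynomial ι K) (reesAlgebra I) (MvPolynomial.X i) ^ lam i =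
            ⟨_, hU i⟩ * algebraMap (MvPolynomial ι K) (reesAlgebra I) (MvPolynomial.X i₀) ^ lam i₀ := by
          refine Subtype.ext ?_
          rw [← map_pow, ← map_pow]
          change monomial 1 _ * C _ = monomial 1 _ * C _
          rw [monomial_mul_C, monomial_mul_C, mul_comm]
        rw [this]
        have hlam : lam i₀ ≠ 0 := fun h => by have := hω i₀; rw [h] at this; omega
        exact P.mul_mem_left _ (P.pow_mem_of_mem hxP _ (Nat.pos_of_ne_zero hlam))
      refine hP.mem_of_pow_mem _ ((hP.mem_or_mem hprod).resolve_left fun h => ?_)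
      refine (notMem_reesCenter hI).mpr ?_ (hPQ h)
      change reesValuation ω L (monomial 1 _) = 0
      rw [MvPolynomial.X_pow_eq_monomial, reesValuation_monomial _ _ one_ne_zero,
        Finsupp.weight_single, smul_eq_mul, hω]
      simp
  exact ringKrullDim_localization_le_one_of_mem_minimalPrimes hmin

theorem isRegularLocal_localization_reesCenter [Nonempty ι] (hL0 : 0 < L)
    (hω : ∀ i, lam i * ω i = L) (hgcd : Finset.univ.gcd ω = 1) {α : ι →₀ ℕ}
    (hα : Finsupp.weight ω α = L + 1) :
    IsRegularLocal (Localization.AtPrime (reesCenter hI)) := by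
  have hπm : monomial 1 (MvPolynomial.monomial α (1 : K)) ∈ reesAlgebra I := by
    rw [reesAlgebra.monomial_mem, pow_one]
    exact monomial_mem hI (by omega)
  set π : reesAlgebra I := ⟨_, hπm⟩ with hπ
  have hπQ : π ∈ reesCenter hI := by
    rw [mem_reesCenter]
    change 0 < reesValuation ω L (monomial 1 _)
    rw [reesValuation_monomial _ _ one_ne_zero, hα]
    exact_mod_cast (by push_cast; ring_nf; norm_num : (0 : ℤ) < ((L + 1 : ℕ) : ℤ) - (1 : ℕ) * L)
  refine isRegularLocal_localization
    (ringKrullDim_localization_reesCenter_le_one hI hL0 hω) hπQ fun f hf => ?_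
  let T : Ideal (reesAlgebra I) :=
    { carrier := {a | ∃ s ∉ reesCenter hI, ∃ b, s * a = π * b}
      zero_mem' := ⟨1, (reesCenter hI).one_notMem, 0, by simp⟩
      add_mem' := by
        rintro a a' ⟨s, hs, b, h⟩ ⟨s', hs', b', h'⟩
        refine ⟨s * s', fun hss => ((reesCenter_isPrime hI).mem_or_mem hss).elim hs hs',
          s' * b + s * b', ?_⟩
        linear_combination s' * h + s * h'
      smul_mem' := by
        rintro c a ⟨s, hs, b, h⟩
        refine ⟨s, hs, c * b, ?_⟩
        rw [smul_eq_mul]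
        linear_combination c * h }
  change f ∈ T
  refine Subalgebra.mem_ideal_of_forall_monomial_mem fun k β hβ => ?_
  set c := ((f : (MvPolynomial ι K)[X]).coeff k).coeff β with hc
  obtain ⟨e, he⟩ : ∃ e : ℕ, Finsupp.weight ω β = k * L + (e + 1) := by
    have h1 := lt_of_lt_of_le ((mem_reesCenter hI).mp hf)
      (reesValuation_le_of_coeff_ne_zero (ω := ω) (L := L) hβ)
    have h2 : (0 : ℤ) < (Finsupp.weight ω β : ℤ) - k * L := by exact_mod_cast h1
    have h3 : k * L + 1 ≤ Finsupp.weight ω β := by zify; linarith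
    exact ⟨Finsupp.weight ω β - (k * L + 1), by omega⟩
  have hmon := monomial_mem_pow hI (f.2 k) hβ
  have hmem : ∀ {j : ℕ} {γ : ι →₀ ℕ} (a : K), MvPolynomial.monomial γ (1 : K) ∈ I ^ j →
      monomial j (MvPolynomial.monomial γ a) ∈ reesAlgebra I := fun {j γ} a h => by
    rw [reesAlgebra.monomial_mem, ← mul_one a, ← MvPolynomial.C_mul_monomial]
    exact Ideal.mul_mem_left _ _ h
  have hweight : ∀ γ : ι →₀ ℕ, (Finsupp.weight ω γ : ℤ) = ∑ i, (ω i : ℤ) * γ i := fun γ => by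
    rw [Finsupp.weight_apply, Finsupp.sum_fintype _ _ (by simp)]
    push_cast [smul_eq_mul]
    exact Finset.sum_congr rfl fun i _ => mul_comm _ _
  obtain ⟨j, j', s, s', h1, h2, h3, h4, h5⟩ := exists_monomial_mem_pow_of_mem_closure (K := K) hI
    (mem_closure_of_lcm_dvd hL0 hω hgcd (c := fun i => (β i : ℤ) - (e + 1) * α i)
      ⟨(k : ℤ) - (e + 1), by
        simp only [mul_sub, Finset.sum_sub_distrib, ← hweight, mul_left_comm _ ((e : ℤ) + 1),
          ← Finset.mul_sum]
        rw [he, hα]; push_cast; ring⟩)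
  have hadd : s + β = s' + (e + 1) • α := by
    ext i
    have := h5 i
    simp only [Finsupp.add_apply, Finsupp.smul_apply, smul_eq_mul]
    zify
    linarith
  have hdeg : j + k = j' + (e + 1) := by
    have := congrArg (Finsupp.weight ω) hadd
    rw [map_add, map_add, map_nsmul, h1, h2, hα, he, smul_eq_mul] at this
    refine Nat.eq_of_mul_eq_mul_right hL0 ?_
    linarith
  refine ⟨⟨_, hmem c hmon⟩, ⟨⟨_, hmem 1 h3⟩, ?_, ⟨_, hmem c h4⟩ * π ^ e, Subtype.ext ?_⟩, rfl⟩
  · rw [notMem_reesCenter]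
    change reesValuation ω L (monomial j _) = 0
    rw [reesValuation_monomial _ _ one_ne_zero, h1]
    simp
  · change monomial j _ * monomial k _ =
      monomial 1 _ * (monomial j' (MvPolynomial.monomial s' c) *
        (monomial 1 (MvPolynomial.monomial α (1 : K))) ^ e)
    simp only [monomial_pow, monomial_mul_monomial, MvPolynomial.monomial_pow,
      MvPolynomial.monomial_mul]
    rw [hadd, hdeg, show j' + (e + 1) = 1 + (j' + 1 * e) by ring,
      show s' + (e + 1) • α = α + (s' + e • α) by rw [succ_nsmul]; abel]
    simp

theorem exists_weight_eq_of_isRegularLocal [Nonempty ι] (hL0 : 0 < L)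
    (hω : ∀ i, lam i * ω i = L) (hgcd : Finset.univ.gcd ω = 1)
    (hreg : IsRegularLocal (Localization.AtPrime (reesCenter hI))) :
    ∃ α : ι →₀ ℕ, Finsupp.weight ω α = L + 1 := by
  by_contra! hα
  have hpos : ∀ i, 0 < ω i := fun i => Nat.pos_of_ne_zero fun h => by
    have := hω i; rw [h] at this; omega
  have hω2 : ∀ i, 2 ≤ ω i := fun i => by
    have h1 := hpos i
    have h2 := hα (Finsupp.single i (L + 1))
    rw [Finsupp.weight_single, smul_eq_mul] at h2
    rcases lt_or_eq_of_le (Nat.succ_le_of_lt h1) with h | h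
    · exact h
    · simp [← h] at h2
  obtain ⟨π, hπQ, hπ⟩ :=
    hreg.exists_generator (ringKrullDim_localization_reesCenter_le_one hI hL0 hω)
  let S : AddSubmonoid (ℕ × (ι →₀ ℕ)) :=
    { carrier := {p | Finsupp.weight ω p.2 = p.1 * L ∨ p.1 * L + 2 ≤ Finsupp.weight ω p.2}
      zero_mem' := by simp
      add_mem' := by
        intro p q hp hq
        simp only [Set.mem_ofPred_eq, Prod.fst_add, Prod.snd_add, map_add, add_mul] at hp hq ⊢
        omega }
  have hS : ∀ {f : reesAlgebra I} {k β},
      ((f : (MvPolynomial ι K)[X]).coeff k).coeff β ≠ 0 → (k, β) ∈ S := fun {f k β} h => by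
    refine mem_of_mem_reesAlgebra_of_coeff_ne_zero (I := I) S (fun β => ?_)
      (fun r hr β hβ => ?_) f.2 h
    · change Finsupp.weight ω β = 0 * L ∨ 0 * L + 2 ≤ Finsupp.weight ω β
      by_cases hβ : β = 0
      · left; simp [hβ]
      · right
        obtain ⟨i, hi⟩ := Finsupp.ne_iff.mp hβ
        have := Finsupp.le_weight_of_ne_zero' (w := ω) hi
        have := hω2 i
        omega
    · change Finsupp.weight ω β = 1 * L ∨ 1 * L + 2 ≤ Finsupp.weight ω β
      have := (hI r).mp hr β hβ
      have := hα β
      omega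
  have hval : ∀ f : reesAlgebra I, f ≠ 0 → ∃ m : ℕ,
      reesValuation ω L (f : (MvPolynomial ι K)[X]) = ((m : ℤ) : WithTop ℤ) ∧ m ≠ 1 := by
    intro f hf
    obtain ⟨k, β, hβ, hv⟩ := exists_reesValuation_eq (ω := ω) (L := L)
      (fun h => hf (Subtype.ext h) : (f : (MvPolynomial ι K)[X]) ≠ 0)
    have h1 : Finsupp.weight ω β = k * L ∨ k * L + 2 ≤ Finsupp.weight ω β := hS hβ
    refine ⟨Finsupp.weight ω β - k * L, ?_, by omega⟩
    rw [hv, Nat.cast_sub (by omega)]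
    push_cast
    rfl
  have hX0 : ∀ i, algebraMap (MvPolynomial ι K) (reesAlgebra I) (MvPolynomial.X i) ≠ 0 :=
    fun i h => MvPolynomial.X_ne_zero (R := K) i <| C_injective <|
      (congrArg Subtype.val h).trans C_0.symm
  have hπ0 : π ≠ 0 := by
    rintro rfl
    obtain ⟨i⟩ := ‹Nonempty ι›
    obtain ⟨s, hs, b, hb⟩ := hπ _ (algebraMap_X_mem_reesCenter hI hpos i)
    rw [zero_mul, mul_eq_zero] at hb
    rcases hb with h | h
    · exact hs (h ▸ (reesCenter hI).zero_mem)
    · exact hX0 i h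
  obtain ⟨e, he, he1⟩ := hval π hπ0
  have he0 : e ≠ 0 := by
    rintro rfl
    rw [mem_reesCenter, he] at hπQ
    exact lt_irrefl _ hπQ
  have hdvd : ∀ (m : ℕ) (f : reesAlgebra I), f ≠ 0 →
      reesValuation ω L (f : (MvPolynomial ι K)[X]) = ((m : ℤ) : WithTop ℤ) → e ∣ m := by
    intro m
    induction m using Nat.strong_induction_on with
    | _ m ih =>
      intro f hf hfm
      rcases Nat.eq_zero_or_pos m with rfl | hm
      · exact dvd_zero _
      obtain ⟨s, hs, b, hb⟩ := hπ f (by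
        rw [mem_reesCenter, hfm]
        exact_mod_cast hm)
      have hs0 : s ≠ 0 := fun h => hs (h ▸ (reesCenter hI).zero_mem)
      have hb0 : b ≠ 0 := by
        rintro rfl
        rw [mul_zero] at hb
        exact mul_ne_zero hs0 hf hb
      obtain ⟨d, hd, -⟩ := hval b hb0
      have h := congrArg (fun a : reesAlgebra I =>
        reesValuation ω L (a : (MvPolynomial ι K)[X])) hb
      change reesValuation ω L ((s : (MvPolynomial ι K)[X]) * (f : (MvPolynomial ι K)[X])) =
        reesValuation ω L ((π : (MvPolynomial ι K)[X]) * (b : (MvPolynomial ι K)[X])) at h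
      rw [AddValuation.map_mul, AddValuation.map_mul, (notMem_reesCenter hI).mp hs, zero_add,
        hfm, he, hd] at h
      have hmed : m = e + d := by exact_mod_cast h
      rw [hmed]
      exact (Nat.dvd_add_right dvd_rfl).mpr (ih d (by omega) b hb0 hd)
  have : e ∣ Finset.univ.gcd ω := Finset.dvd_gcd fun i _ => by
    refine hdvd _ _ (hX0 i) ?_
    change reesValuation ω L
      (monomial 0 (MvPolynomial.monomial (Finsupp.single i 1) (1 : K))) = _
    rw [reesValuation_monomial _ _ one_ne_zero, Finsupp.weight_single]
    simp
  rw [hgcd, Nat.dvd_one] at this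
  exact he1 this

end ReesCenter

/-- With `λ` positive integers, `L = lcm(λ)`, `ω_i = L/λ_i`,
`I = I(λ) = \overline{(x_1^{λ_1}, …, x_n^{λ_n})} ⊆ R = K[x_1, …, x_n]`, the Rees algebra
`R[It]` satisfies Serre's condition `R_1` (its localization at every prime of height at
most one — i.e. whose localization has Krull dimension at most one — is a regular local
ring) if and only if there is `α ∈ ℕ^n` with `ω·α = L + 1`, equivalently `L + 1` lies in
the additive submonoid of `ℕ` generated by `ω_1, …, ω_n`. -/
theorem rees_algebra_R1_iff_almost_quasinormal
    {K : Type*} [Field K] {n : ℕ} (hn : 0 < n)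
    (lam : Fin n → ℕ) (hlam : ∀ i, 0 < lam i)
    (L : ℕ) (hL : L = Finset.univ.lcm lam)
    (ω : Fin n → ℕ) (hω : ∀ i, ω i = L / lam i)
    (J Ilam : Ideal (MvPolynomial (Fin n) K))
    (hJ : J = Ideal.span (Set.range fun i => (MvPolynomial.X i : MvPolynomial (Fin n) K) ^ lam i))
    -- `I(λ)` is the integral closure of `J(λ)`
    (hIlam : ∀ x : MvPolynomial (Fin n) K, x ∈ Ilam ↔ IdealIntegral J x) :
    (∀ (P : Ideal ↥(reesAlgebra Ilam)) [P.IsPrime],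
        ringKrullDim (Localization.AtPrime P) ≤ 1 →
        IsRegularLocal (Localization.AtPrime P)) ↔
      (∃ α : Fin n → ℕ, ∑ i, ω i * α i = L + 1) := by
  have : Nonempty (Fin n) := ⟨⟨0, hn⟩⟩
  have hL0 : 0 < L := by
    rw [hL, Nat.pos_iff_ne_zero, Ne, Finset.lcm_eq_zero_iff]
    rintro ⟨i, -, hi⟩
    exact (hlam i).ne' hi
  have hωL : ∀ i, lam i * ω i = L := fun i => by
    rw [hω, Nat.mul_div_cancel' (hL ▸ Finset.dvd_lcm (Finset.mem_univ i))]
  have hpos : ∀ i, 0 < ω i := fun i => Nat.pos_of_ne_zero fun h => by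
    have := hωL i; rw [h] at this; omega
  have hgcd := gcd_lcm_div_eq_one hL hL0 hωL
  have hI : ∀ r, r ∈ Ilam ↔ ∀ β, r.coeff β ≠ 0 → L ≤ Finsupp.weight ω β := fun r => by
    rw [hIlam, hJ, idealIntegral_span_X_pow_iff hL0 hωL]
  have hweight : ∀ α : Fin n →₀ ℕ, Finsupp.weight ω α = ∑ i, ω i * α i := fun α => by
    rw [Finsupp.weight_apply, Finsupp.sum_fintype _ _ (by simp)]
    exact Finset.sum_congr rfl fun i _ => mul_comm _ _
  constructor
  · intro h
    obtain ⟨α, hα⟩ := exists_weight_eq_of_isRegularLocal hI hL0 hωL hgcd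
      (h _ (ringKrullDim_localization_reesCenter_le_one hI hL0 hωL))
    exact ⟨α, (hweight α).symm.trans hα⟩
  · rintro ⟨α, hα⟩ P _ hP
    by_cases hX : ∀ i, algebraMap (MvPolynomial (Fin n) K) (reesAlgebra Ilam)
        (MvPolynomial.X i) ∈ P
    · have hne : reesCenter hI ≠ ⊥ := fun h => by
        have := algebraMap_X_mem_reesCenter hI hpos ⟨0, hn⟩
        rw [h, Ideal.mem_bot] at this
        exact MvPolynomial.X_ne_zero (R := K) _ <| Polynomial.C_injective <|
          (congrArg Subtype.val this).trans Polynomial.C_0.symm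
      obtain rfl := eq_of_le_of_ringKrullDim_localization_le_one hP
        (reesCenter_le hI hL0 hωL hX) hne
      exact isRegularLocal_localization_reesCenter hI hL0 hωL hgcd
        (α := Finsupp.equivFunOnFinite.symm α) (by simpa [hweight] using hα)
    · push Not at hX
      obtain ⟨i, hi⟩ := hX
      exact isRegularLocal_of_algebraMap_X_notMem hI hωL hP hi
end

section
/- Let n ≥ 2, let λ = (λ_1,…,λ_n) be a vector of positive integers, let ℓ = lcm(λ_1,…,λ_{n−1}), and set λ′ = (λ_1,…,λ_{n−1}, λ_n + ℓ). If the ideal I(λ′) ⊆ K[x_1,…,x_n] is normal, then I(λ) is normal. If moreover λ_n ≥ ℓ and I(λ) is normal, then I(λ′) is normal. -/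
section

open MvPolynomial Finsupp

theorem AddMonoidHom.monotone_of_finsupp_nat {σ : Type*} (t : (σ →₀ ℕ) →+ ℕ) : Monotone t := by
  intro a b hab
  obtain ⟨c, rfl⟩ := le_iff_exists_add.1 hab
  rw [map_add]
  exact Nat.le_add_right _ _

/-- The ideal of polynomials all of whose monomials have weight at least `d`. -/
def MvPolynomial.weightIdeal {σ : Type*} (R : Type*) [CommRing R] (w : σ → ℕ) (d : ℕ) :
    Ideal (MvPolynomial σ R) where
  carrier := {f | (d : ℕ∞) ≤ (f : MvPowerSeries σ R).weightedOrder w}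
  zero_mem' := by simp
  add_mem' {f g} hf hg := by
    simp only [Set.mem_ofPred_eq, coe_add] at *
    exact (le_min hf hg).trans (MvPowerSeries.min_weightedOrder_le_add w)
  smul_mem' c f hf := by
    simp only [Set.mem_ofPred_eq, smul_eq_mul, coe_mul] at *
    exact hf.trans (le_add_self.trans (MvPowerSeries.le_weightedOrder_mul w))

section WeightIdeal

variable {σ R : Type*} [CommRing R] {w : σ → ℕ} {d e : ℕ} {f g : MvPolynomial σ R}

theorem MvPolynomial.mem_weightIdeal :
    f ∈ weightIdeal R w d ↔ (d : ℕ∞) ≤ (f : MvPowerSeries σ R).weightedOrder w :=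
  Iff.rfl

theorem MvPolynomial.mem_weightIdeal_iff_support :
    f ∈ weightIdeal R w d ↔ ∀ a ∈ f.support, d ≤ weight w a := by
  rw [mem_weightIdeal]
  constructor
  · intro h a ha
    have := h.trans (MvPowerSeries.weightedOrder_le w (d := a) (by simpa using ha))
    exact_mod_cast this
  · intro h
    refine MvPowerSeries.nat_le_weightedOrder w fun a ha ↦ ?_
    by_contra hc
    exact absurd (h a (by simpa using hc)) (not_le.2 ha)

theorem MvPolynomial.weightIdeal_eq_span :
    weightIdeal R w d =
      Ideal.span ((fun a ↦ monomial a (1 : R)) '' {a | d ≤ weight w a}) := by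
  ext f
  rw [mem_weightIdeal_iff_support, mem_ideal_span_monomial_image]
  refine forall₂_congr fun a _ ↦ ⟨fun h ↦ ⟨a, h, le_rfl⟩, ?_⟩
  rintro ⟨b, hb, hba⟩
  exact le_trans hb ((weight w).monotone_of_finsupp_nat hba)

theorem MvPolynomial.weightIdeal_mul_mem (hf : f ∈ weightIdeal R w d)
    (hg : g ∈ weightIdeal R w e) : f * g ∈ weightIdeal R w (d + e) := by
  rw [mem_weightIdeal] at *
  rw [coe_mul, Nat.cast_add]
  exact (add_le_add hf hg).trans (MvPowerSeries.le_weightedOrder_mul w)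

theorem MvPolynomial.weightIdeal_pow_le (k : ℕ) :
    weightIdeal R w d ^ k ≤ weightIdeal R w (k * d) := by
  induction k with
  | zero => intro x _; simp [mem_weightIdeal]
  | succ k ih =>
    rw [pow_succ, Ideal.mul_le, Nat.succ_mul]
    exact fun x hx y hy ↦ weightIdeal_mul_mem (ih hx) hy

theorem MvPolynomial.weightedOrder_pow [IsDomain R] (f : MvPolynomial σ R) (m : ℕ) :
    ((f ^ m : MvPolynomial σ R) : MvPowerSeries σ R).weightedOrder w =
      m * (f : MvPowerSeries σ R).weightedOrder w := by
  induction m with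
  | zero => simp
  | succ m ih =>
    rw [pow_succ, coe_mul, MvPowerSeries.weightedOrder_mul, ih, Nat.cast_succ, add_mul, one_mul]

theorem IdealIntegral.mem_weightIdeal [IsDomain R] {I : Ideal (MvPolynomial σ R)}
    (hI : I ≤ weightIdeal R w d) (hf : IdealIntegral I f) : f ∈ weightIdeal R w d := by
  obtain ⟨m, hm, a, ha, hsum⟩ := hf
  rw [MvPolynomial.mem_weightIdeal]
  by_contra! hlt
  obtain ⟨v, hv⟩ := ENat.ne_top_iff_exists.mp (ne_top_of_lt hlt)
  rw [← hv, Nat.cast_lt] at hlt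
  have hpow (j : ℕ) : f ^ j ∈ weightIdeal R w (j * v) := by
    rw [MvPolynomial.mem_weightIdeal, weightedOrder_pow, ← hv]
    exact_mod_cast le_rfl
  have hmem : f ^ m ∈ weightIdeal R w (m * v + 1) := by
    rw [eq_neg_of_add_eq_zero_left hsum, neg_mem_iff]
    refine sum_mem fun j hj ↦ ?_
    have h1 := weightIdeal_mul_mem (weightIdeal_pow_le j (Ideal.pow_right_mono hI j (ha j hj)))
      (hpow (m - j))
    rw [MvPolynomial.mem_weightIdeal] at h1 ⊢
    refine le_trans ?_ h1
    obtain ⟨hj1, hjm⟩ := Finset.mem_Icc.1 hj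
    obtain ⟨r, rfl⟩ := Nat.exists_eq_add_of_le hjm
    rw [Nat.add_sub_cancel_left]
    norm_cast
    nlinarith [Nat.mul_le_mul_left j (Nat.succ_le_of_lt hlt)]
  rw [MvPolynomial.mem_weightIdeal, weightedOrder_pow, ← hv] at hmem
  norm_cast at hmem
  omega

end WeightIdeal

theorem IdealIntegral.of_pow_mem {R : Type*} [CommRing R] {I : Ideal R} {x : R} {m : ℕ}
    (hm : 0 < m) (hx : x ^ m ∈ I ^ m) : IdealIntegral I x := by
  refine ⟨m, hm, fun j ↦ if j = m then -x ^ m else 0, fun j _ ↦ ?_, ?_⟩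
  · dsimp only
    split_ifs with h
    · subst h
      exact neg_mem hx
    · exact zero_mem _
  · rw [Finset.sum_eq_single_of_mem m (Finset.mem_Icc.2 ⟨hm, le_rfl⟩)]
    · simp
    · intro j _ hj
      simp [hj]

/-- The combinatorial form of normality: every exponent of weight at least `k * d` dominates a sum
of `k` exponents of weight at least `d`. -/
def Decomposable {σ : Type*} (q : (σ →₀ ℕ) → ℕ) (d : ℕ) : Prop :=
  ∀ k : ℕ, 0 < k → ∀ a : σ →₀ ℕ, k * d ≤ q a →
    ∃ f : Fin k → σ →₀ ℕ, (∀ j, d ≤ q (f j)) ∧ ∑ j, f j ≤ a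

section Normal

variable {σ K : Type*} [Field K] {w lam : σ → ℕ} {d : ℕ}

theorem MvPolynomial.mem_weightIdeal_pow {R : Type*} [CommRing R] {f : MvPolynomial σ R} {k : ℕ} :
    f ∈ weightIdeal R w d ^ k ↔ ∀ a ∈ f.support,
      ∃ g : Fin k → σ →₀ ℕ, (∀ j, d ≤ weight w (g j)) ∧ ∑ j, g j ≤ a := by
  have hpow : weightIdeal R w d ^ k = Ideal.span ((fun a ↦ monomial a (1 : R)) ''
      {a | ∃ g : Fin k → σ →₀ ℕ, (∀ j, d ≤ weight w (g j)) ∧ ∑ j, g j = a}) := by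
    rw [weightIdeal_eq_span, Ideal.span, Submodule.span_pow, Ideal.span]
    congr 1
    ext x
    rw [Set.mem_pow_iff_prod]
    constructor
    · rintro ⟨p, hp, rfl⟩
      choose g hg hgp using hp
      refine ⟨∑ j, g j, ⟨g, hg, rfl⟩, ?_⟩
      simp only [monomial_sum_one]
      exact Finset.prod_congr rfl fun j _ ↦ hgp j
    · rintro ⟨_, ⟨g, hg, rfl⟩, rfl⟩
      exact ⟨fun j ↦ monomial (g j) 1, fun j ↦ ⟨g j, hg j, rfl⟩, (monomial_sum_one _ _).symm⟩
  rw [hpow, mem_ideal_span_monomial_image]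
  refine forall₂_congr fun a _ ↦ ?_
  constructor
  · rintro ⟨_, ⟨g, hg, rfl⟩, hle⟩
    exact ⟨g, hg, hle⟩
  · rintro ⟨g, hg, hle⟩
    exact ⟨_, ⟨g, hg, rfl⟩, hle⟩

theorem MvPolynomial.monomial_pow_mem_span_X_pow {R : Type*} [CommRing R]
    (hw : ∀ i, lam i * w i = d) (a : σ →₀ ℕ) :
    (monomial a (1 : R)) ^ d ∈ Ideal.span (Set.range fun i ↦ (X i : MvPolynomial σ R) ^ lam i) ^
      weight w a := by
  rw [monomial_eq, C_1, one_mul, Finsupp.prod, ← Finset.prod_pow, weight_apply, Finsupp.sum,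
    ← Finset.prod_pow_eq_pow_sum]
  refine Ideal.prod_mem_prod fun i _ ↦ ?_
  rw [← pow_mul, ← hw i, smul_eq_mul, show a i * (lam i * w i) = lam i * (a i * w i) by ring,
    pow_mul (X i)]
  have hi : (X i : MvPolynomial σ R) ^ lam i ∈ Ideal.span (Set.range fun i ↦ X i ^ lam i) :=
    Ideal.subset_span ⟨i, rfl⟩
  exact Ideal.pow_mem_pow hi _

theorem normal_iff_decomposable (hd : 0 < d) (hw : ∀ i, lam i * w i = d)
    {J I : Ideal (MvPolynomial σ K)}
    (hJ : J = Ideal.span (Set.range fun i ↦ (X i : MvPolynomial σ K) ^ lam i))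
    (hI : ∀ x, x ∈ I ↔ IdealIntegral J x) :
    (∀ k : ℕ, 0 < k → ∀ x, IdealIntegral (I ^ k) x → x ∈ I ^ k) ↔
      Decomposable (weight w) d := by
  have hJw : J ≤ weightIdeal K w d := by
    rw [hJ, Ideal.span_le]
    rintro _ ⟨i, rfl⟩
    change X i ^ lam i ∈ weightIdeal K w d
    rw [X_pow_eq_monomial, mem_weightIdeal_iff_support]
    intro a ha
    rw [Finset.mem_singleton.1 (support_monomial_subset ha), weight_single, smul_eq_mul, hw]
  have hJI : J ≤ I := fun x hx ↦ (hI x).2 (.of_pow_mem one_pos (by simpa using hx))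
  have hint {k : ℕ} {a : σ →₀ ℕ} (ha : k * d ≤ weight w a) :
      IdealIntegral (J ^ k) (monomial a (1 : K)) := by
    refine .of_pow_mem hd ?_
    rw [← pow_mul]
    exact Ideal.pow_le_pow_right ha (hJ ▸ monomial_pow_mem_span_X_pow hw a)
  have hIw : I = weightIdeal K w d := by
    refine le_antisymm (fun x hx ↦ ((hI x).1 hx).mem_weightIdeal hJw) ?_
    rw [weightIdeal_eq_span, Ideal.span_le]
    rintro _ ⟨a, ha, rfl⟩
    refine (hI _).2 ?_
    simpa using hint (k := 1) (by simpa using ha)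
  have hmono {k : ℕ} {x : MvPolynomial σ K} (hx : IdealIntegral (J ^ k) x) :
      IdealIntegral (I ^ k) x := by
    obtain ⟨m, hm, a, ha, hsum⟩ := hx
    exact ⟨m, hm, a, fun j hj ↦ Ideal.pow_right_mono (Ideal.pow_right_mono hJI k) j (ha j hj),
      hsum⟩
  constructor
  · intro h k hk a ha
    have hmem := h k hk _ (hmono (hint ha))
    rw [hIw, mem_weightIdeal_pow] at hmem
    exact hmem a (by classical simp [coeff_monomial])
  · intro h k hk x hx
    rw [hIw] at hx ⊢
    have hxw := mem_weightIdeal_iff_support.1 (hx.mem_weightIdeal (weightIdeal_pow_le k))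
    exact mem_weightIdeal_pow.2 fun a ha ↦ h k hk a (hxw a ha)

end Normal

section Shift

variable {σ : Type*} {i₀ : σ} {t : (σ →₀ ℕ) →+ ℕ} {p ℓ : ℕ}

theorem Finsupp.sum_update_le {ι : Type*} [Fintype ι] {f : ι → σ →₀ ℕ} {c : ι → ℕ}
    {a : σ →₀ ℕ} {m : ℕ} (hf : ∑ j, f j ≤ a.update i₀ m) (hc : ∑ j, c j ≤ a i₀) :
    ∑ j, (f j).update i₀ (c j) ≤ a := by
  classical
  intro i
  have := hf i
  rw [finsetSum_apply] at this ⊢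
  simp only [coe_update, Function.update_apply] at this ⊢
  by_cases hi : i = i₀
  · simpa [hi] using hc
  · simpa [hi] using this

theorem mul_sub_le_sum_sub {k ℓ t : ℕ} {s : Fin k → ℕ} (h : ∑ j, s j ≤ t) :
    k * ℓ - t ≤ ∑ j, (ℓ - s j) := by
  have : ∑ _j : Fin k, ℓ ≤ ∑ j, ((ℓ - s j) + s j) := Finset.sum_le_sum fun j _ ↦ by omega
  rw [Finset.sum_add_distrib] at this
  simp only [Finset.sum_const, Finset.card_univ, Fintype.card_fin, smul_eq_mul] at this
  omega

theorem Decomposable.of_add (hℓ : 0 < ℓ) (ht : ∀ a c, t (a.update i₀ c) = t a)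
    (h : Decomposable (fun a ↦ (p + ℓ) * t a + ℓ * a i₀) ((p + ℓ) * ℓ)) :
    Decomposable (fun a ↦ p * t a + ℓ * a i₀) (p * ℓ) := by
  classical
  intro k hk a ha
  obtain ⟨f, hf, hle⟩ := h k hk (a.update i₀ (a i₀ + (k * ℓ - t a))) (by
    simp only [ht, coe_update, Function.update_self]
    rcases le_total (k * ℓ) (t a) with h | h
    · nlinarith
    · obtain ⟨r, hr⟩ := Nat.exists_eq_add_of_le h
      rw [hr, Nat.add_sub_cancel_left]
      nlinarith)
  have hsub (j : Fin k) : ℓ - t (f j) ≤ f j i₀ := by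
    have := hf j
    by_contra! hc
    have hlt : t (f j) < ℓ := by omega
    obtain ⟨r, hr⟩ := Nat.exists_eq_add_of_le hlt.le
    have hc' : f j i₀ < r := by omega
    have h1 := Nat.mul_lt_mul_of_pos_left hc' hℓ
    have h2 : (p + ℓ) * ℓ = (p + ℓ) * t (f j) + (p + ℓ) * r := by rw [← mul_add, ← hr]
    nlinarith
  refine ⟨fun j ↦ (f j).update i₀ (f j i₀ - (ℓ - t (f j))), fun j ↦ ?_, ?_⟩
  · have h1 := hf j
    have h2 := hsub j
    simp only [ht, coe_update, Function.update_self] at h1 ⊢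
    rcases le_total ℓ (t (f j)) with h | h
    · nlinarith
    · obtain ⟨r, hr⟩ := Nat.exists_eq_add_of_le h
      obtain ⟨c, hc⟩ := Nat.exists_eq_add_of_le h2
      rw [hc, Nat.add_sub_cancel_left]
      have hr' : ℓ - t (f j) = r := by omega
      rw [hc, hr'] at h1
      have h3 : (p + ℓ) * ℓ = p * ℓ + ℓ * t (f j) + ℓ * r := by
        rw [add_mul, add_assoc, ← mul_add, ← hr]
      nlinarith
  · refine sum_update_le hle ?_
    have h1 := hle i₀
    have h2 := t.monotone_of_finsupp_nat hle
    rw [ht, map_sum] at h2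
    rw [finsetSum_apply] at h1
    simp only [coe_update, Function.update_self] at h1
    have h3 : ∑ j, (f j i₀ - (ℓ - t (f j))) + ∑ j, (ℓ - t (f j)) = ∑ j, f j i₀ := by
      rw [← Finset.sum_add_distrib]
      exact Finset.sum_congr rfl fun j _ ↦ Nat.sub_add_cancel (hsub j)
    have h4 := mul_sub_le_sum_sub (ℓ := ℓ) h2
    omega

theorem Decomposable.add (hℓ : 0 < ℓ) (hp : ℓ ≤ p) (ht : ∀ a c, t (a.update i₀ c) = t a)
    (h : Decomposable (fun a ↦ p * t a + ℓ * a i₀) (p * ℓ)) :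
    Decomposable (fun a ↦ (p + ℓ) * t a + ℓ * a i₀) ((p + ℓ) * ℓ) := by
  classical
  intro k hk a ha
  set u := k * ℓ - t a with hu
  obtain ⟨c, hc1, hc2⟩ : ∃ c, p * u ≤ ℓ * c ∧ ℓ * c < p * u + ℓ := by
    refine ⟨(p * u + ℓ - 1) / ℓ, ?_, ?_⟩ <;>
    have h1 := Nat.div_add_mod (p * u + ℓ - 1) ℓ <;>
    have h2 := Nat.mod_lt (p * u + ℓ - 1) hℓ <;> omega
  obtain ⟨f, hf, hle⟩ := h k hk (a.update i₀ c) (by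
    simp only [ht, coe_update, Function.update_self]
    have : k * ℓ ≤ u + t a := by omega
    nlinarith [Nat.mul_le_mul_left p this])
  refine ⟨fun j ↦ (f j).update i₀ (f j i₀ + (ℓ - t (f j))), fun j ↦ ?_, ?_⟩
  · have h1 := hf j
    simp only [ht, coe_update, Function.update_self] at h1 ⊢
    have : ℓ ≤ (ℓ - t (f j)) + t (f j) := by omega
    nlinarith [Nat.mul_le_mul_left ℓ this]
  · refine sum_update_le hle ?_
    rw [Finset.sum_add_distrib]
    have h1 := hle i₀
    rw [finsetSum_apply] at h1
    simp only [coe_update, Function.update_self] at h1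
    have h2 : p * ∑ j, (ℓ - t (f j)) ≤ ℓ * ∑ j, f j i₀ := by
      rw [Finset.mul_sum, Finset.mul_sum]
      refine Finset.sum_le_sum fun j _ ↦ ?_
      rw [Nat.mul_sub, tsub_le_iff_left]
      exact hf j
    have h3 : ∑ j, (ℓ - t (f j)) < u + 1 := by
      refine lt_of_mul_lt_mul_left (a := p) ?_ (Nat.zero_le _)
      nlinarith [Nat.mul_le_mul_left ℓ h1]
    have h4 : c + u < a i₀ + 1 := by
      refine lt_of_mul_lt_mul_left (a := ℓ) ?_ (Nat.zero_le _)
      have h5 : (p + ℓ) * u ≤ ℓ * a i₀ := by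
        rw [hu, Nat.mul_sub, tsub_le_iff_left]
        calc (p + ℓ) * (k * ℓ) = k * ((p + ℓ) * ℓ) := mul_left_comm _ _ _
          _ ≤ _ := ha
      nlinarith
    omega

end Shift

theorem weight_ite_eq_mul_add {σ : Type*} [DecidableEq σ] (i₀ : σ) (v : σ → ℕ) (p ℓ : ℕ)
    (a : σ →₀ ℕ) :
    weight (fun i ↦ if i = i₀ then ℓ else p * v i) a =
      p * weight (fun i ↦ if i = i₀ then 0 else v i) a + ℓ * a i₀ := by
  induction a using Finsupp.induction_linear with
  | zero => simp
  | add f g hf hg => simp only [map_add, hf, hg, Finsupp.add_apply]; ring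
  | single i c =>
    by_cases hi : i = i₀
    · subst hi
      simp [weight_single, mul_comm]
    · simp [weight_single, hi, Ne.symm hi, mul_left_comm]

end

/-- Work in `K[x_1, …, x_{n+1}]` (so the number of variables is `≥ 2`).
Let `λ = (λ_1, …, λ_{n+1})` be positive integers, `ℓ = lcm(λ_1, …, λ_n)`, and
`λ′ = (λ_1, …, λ_n, λ_{n+1} + ℓ)`.  If `I(λ′)` is normal, then `I(λ)` is normal; and if
moreover `λ_{n+1} ≥ ℓ` and `I(λ)` is normal, then `I(λ′)` is normal. -/
theorem I_lambda_normal_congruence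
    {K : Type*} [Field K] {n : ℕ} (hn : 1 ≤ n)
    (lam : Fin (n + 1) → ℕ) (hlam : ∀ i, 0 < lam i)
    (ℓ : ℕ) (hℓ : ℓ = (Finset.univ.erase (Fin.last n)).lcm lam)
    (lam' : Fin (n + 1) → ℕ)
    (hlam' : lam' = Function.update lam (Fin.last n) (lam (Fin.last n) + ℓ))
    (J J' Ilam Ilam' : Ideal (MvPolynomial (Fin (n + 1)) K))
    (hJ : J = Ideal.span
      (Set.range fun i => (MvPolynomial.X i : MvPolynomial (Fin (n + 1)) K) ^ lam i))
    (hJ' : J' = Ideal.span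
      (Set.range fun i => (MvPolynomial.X i : MvPolynomial (Fin (n + 1)) K) ^ lam' i))
    -- `I(λ)` and `I(λ′)` are the integral closures of `J(λ)` and `J(λ′)`
    (hIlam : ∀ x : MvPolynomial (Fin (n + 1)) K, x ∈ Ilam ↔ IdealIntegral J x)
    (hIlam' : ∀ x : MvPolynomial (Fin (n + 1)) K, x ∈ Ilam' ↔ IdealIntegral J' x) :
    ((∀ k : ℕ, 0 < k → ∀ x : MvPolynomial (Fin (n + 1)) K,
        IdealIntegral (Ilam' ^ k) x → x ∈ Ilam' ^ k) →
      (∀ k : ℕ, 0 < k → ∀ x : MvPolynomial (Fin (n + 1)) K,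
        IdealIntegral (Ilam ^ k) x → x ∈ Ilam ^ k)) ∧
    (ℓ ≤ lam (Fin.last n) →
      (∀ k : ℕ, 0 < k → ∀ x : MvPolynomial (Fin (n + 1)) K,
        IdealIntegral (Ilam ^ k) x → x ∈ Ilam ^ k) →
      (∀ k : ℕ, 0 < k → ∀ x : MvPolynomial (Fin (n + 1)) K,
        IdealIntegral (Ilam' ^ k) x → x ∈ Ilam' ^ k)) := by
  classical
  have hℓ0 : 0 < ℓ := by
    rw [hℓ, Nat.pos_iff_ne_zero, Ne, Finset.lcm_eq_zero_iff]
    rintro ⟨i, -, hi⟩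
    exact (hlam i).ne' hi
  have hdvd (i : Fin (n + 1)) (hi : i ≠ Fin.last n) : lam i * (ℓ / lam i) = ℓ :=
    Nat.mul_div_cancel' (hℓ ▸ Finset.dvd_lcm (Finset.mem_erase.2 ⟨hi, Finset.mem_univ i⟩))
  set p := lam (Fin.last n) with hp
  have hp0 : 0 < p := hlam _
  let t : (Fin (n + 1) →₀ ℕ) →+ ℕ :=
    Finsupp.weight fun i ↦ if i = Fin.last n then 0 else ℓ / lam i
  have ht (a : Fin (n + 1) →₀ ℕ) (c : ℕ) : t (a.update (Fin.last n) c) = t a := by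
    have hz (b : ℕ) : t (Finsupp.single (Fin.last n) b) = 0 := by simp [t, Finsupp.weight_single]
    rw [Finsupp.update_eq_erase_add_single, map_add, hz]
    conv_rhs => rw [← Finsupp.erase_add_single (Fin.last n) a, map_add, hz]
  have key := normal_iff_decomposable (d := p * ℓ) (Nat.mul_pos hp0 hℓ0)
    (w := fun i ↦ if i = Fin.last n then ℓ else p * (ℓ / lam i)) (fun i ↦ by
      by_cases hi : i = Fin.last n
      · simp [hi, hp]
      · simp only [hi, if_false]
        rw [mul_left_comm, hdvd i hi]) hJ hIlam
  have key' := normal_iff_decomposable (d := (p + ℓ) * ℓ)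
    (Nat.mul_pos (Nat.add_pos_left hp0 _) hℓ0)
    (w := fun i ↦ if i = Fin.last n then ℓ else (p + ℓ) * (ℓ / lam i)) (fun i ↦ by
      by_cases hi : i = Fin.last n
      · simp [hi, hlam']
      · simp only [hi, if_false, hlam', Function.update_of_ne hi]
        rw [mul_left_comm, hdvd i hi]) hJ' hIlam'
  have hw (q : ℕ) : ⇑(Finsupp.weight fun i ↦ if i = Fin.last n then ℓ else q * (ℓ / lam i)) =
      fun a ↦ q * t a + ℓ * a (Fin.last n) :=
    funext fun a ↦ weight_ite_eq_mul_add _ _ q ℓ a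
  rw [hw] at key key'
  rw [key, key']
  exact ⟨Decomposable.of_add hℓ0 ht, fun hle ↦ Decomposable.add hℓ0 hle ht⟩
end
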